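/- arXiv:1003.3825 — 3 statements merged into one kernel-verified Lean document; each statement's English description precedes it below -/
import Mathlib

section
/- A sequence (h_0 = 1, h_1, …, h_e) of positive integers is differentiable if and only if it is the 'first half' of a pure O-sequence; precisely, it is differentiable if and only if there exists a pure O-sequence (g_0, g_1, …, g_{e'}) of socle degree e' with ⌊e'/2⌋ ≥ e such that g_i = h_i for all 0 ≤ i ≤ e (and in that case one may take e' = 2e). -/
/-- The degree of a monomial, given by its exponent vector. -/
def monDeg {r : ℕ} (M : Fin r → ℕ) : ℕ := ∑ j, M j

/-- `X` is a (monomial) order ideal: a nonempty finite set of monomials (exponent vectors)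
closed under divisibility. -/
def IsOrderIdeal {r : ℕ} (X : Finset (Fin r → ℕ)) : Prop :=
  X.Nonempty ∧ ∀ M ∈ X, ∀ N : Fin r → ℕ, (∀ j, N j ≤ M j) → N ∈ X

/-- `M` is a maximal monomial of `X` with respect to divisibility. -/
def IsMaxMon {r : ℕ} (X : Finset (Fin r → ℕ)) (M : Fin r → ℕ) : Prop :=
  M ∈ X ∧ ∀ N ∈ X, (∀ j, M j ≤ N j) → N = M

/-- `X` is a pure order ideal with socle degree `e`: it is an order ideal whose maximal
degree is `e` and all of whose maximal monomials have degree `e`. -/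
def IsPureWithSocle {r : ℕ} (X : Finset (Fin r → ℕ)) (e : ℕ) : Prop :=
  IsOrderIdeal X ∧ (∀ M ∈ X, monDeg M ≤ e) ∧ (∃ M ∈ X, monDeg M = e) ∧
    ∀ M, IsMaxMon X M → monDeg M = e

/-- `h` agrees in degrees `≤ e` with the h-vector of `X`. -/
def HasHVector {r : ℕ} (X : Finset (Fin r → ℕ)) (h : ℕ → ℕ) (e : ℕ) : Prop :=
  ∀ i ≤ e, h i = (X.filter fun M => monDeg M = i).card

/-- `h` is (in degrees `≤ e`) a pure O-sequence of socle degree `e`. -/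
def IsPureOSeq (h : ℕ → ℕ) (e : ℕ) : Prop :=
  ∃ (r : ℕ) (X : Finset (Fin r → ℕ)), IsPureWithSocle X e ∧ HasHVector X h e

/-- `h` is a pure O-sequence of socle degree `e` and type `t`. -/
def IsPureOSeqOfType (h : ℕ → ℕ) (e t : ℕ) : Prop :=
  ∃ (r : ℕ) (X : Finset (Fin r → ℕ)), IsPureWithSocle X e ∧ HasHVector X h e ∧
    {M : Fin r → ℕ | IsMaxMon X M}.ncard = t

/-- `((n)_(d))_1^1`, computed from the `d`-binomial (Macaulay) expansion of `n`
obtained greedily; by convention `((0)_(d))_1^1 = 0`. -/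
def macaulayBound : ℕ → ℕ → ℕ
  | 0, _ => 0
  | (n+1), d =>
      Nat.choose (Nat.findGreatest (fun k => Nat.choose k d ≤ n + 1) (n + 1 + d) + 1) (d + 1) +
        macaulayBound
          ((n + 1) - Nat.choose (Nat.findGreatest (fun k => Nat.choose k d ≤ n + 1) (n + 1 + d)) d)
          (d - 1)
  termination_by n d => n
  decreasing_by
    have hd : d ≤ Nat.findGreatest (fun k => Nat.choose k d ≤ n + 1) (n + 1 + d) :=
      Nat.le_findGreatest (by omega) (by simp [Nat.choose_self])
    have hpos := Nat.choose_pos hd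
    omega

/-- `g` satisfies Macaulay's bound (in degrees `1 ≤ i ≤ e - 1`). -/
def SatisfiesMacaulay (g : ℕ → ℕ) (e : ℕ) : Prop :=
  ∀ i, 1 ≤ i → i + 1 ≤ e → g (i + 1) ≤ macaulayBound (g i) i

/-- `h` is an O-sequence of socle degree `e`. -/
def IsOSeq (h : ℕ → ℕ) (e : ℕ) : Prop :=
  h 0 = 1 ∧ (∀ i ≤ e, 0 < h i) ∧ SatisfiesMacaulay h e

/-- `h` is differentiable: its first difference `(1, h 1 - h 0, …, h e - h (e-1))`
consists of nonnegative integers and satisfies Macaulay's bound. -/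
def IsDifferentiable (h : ℕ → ℕ) (e : ℕ) : Prop :=
  h 0 = 1 ∧ (∀ i, 1 ≤ i → i ≤ e → h (i - 1) ≤ h i) ∧
    SatisfiesMacaulay (fun i => if i = 0 then 1 else h i - h (i - 1)) e


section Part1

/-! ### Numerics of `macaulayBound` -/

lemma mb_zero (d : ℕ) : macaulayBound 0 d = 0 := by
  rw [macaulayBound]

lemma mb_step {n d k : ℕ} (hn : 0 < n) (h1 : k.choose d ≤ n) (h2 : n < (k + 1).choose d) (hd : 1 ≤ d) :
    macaulayBound n d = (k + 1).choose (d + 1) + macaulayBound (n - k.choose d) (d - 1) := by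
  obtain ⟨n, rfl⟩ : ∃ m, n = m + 1 := ⟨n - 1, by omega⟩
  have hk : Nat.findGreatest (fun k => Nat.choose k d ≤ n + 1) (n + 1 + d) = k := by
    rw [Nat.findGreatest_eq_iff]
    refine ⟨?_, fun _ => h1, ?_⟩
    · by_contra hlt
      push Not at hlt
      have h3 : (n + 1 + d).choose d ≤ k.choose d := Nat.choose_le_choose d hlt.le
      have h4 : n + 1 < (n + 1 + d).choose d := by
        have : (n + 1 + d).choose d = (n + 1 + d).choose (n + 1) := by
          rw [Nat.choose_symm_of_eq_add]; omega
        obtain ⟨d, rfl⟩ : ∃ m, d = m + 1 := ⟨d - 1, by omega⟩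
        have h5 : (n + 1 + 1).choose (n + 1) ≤ (n + 1 + (d + 1)).choose (n + 1) :=
          Nat.choose_le_choose _ (by omega)
        rw [Nat.choose_succ_self_right] at h5
        omega
      omega
    · intro m hm _ hc
      have := Nat.choose_le_choose d (show k + 1 ≤ m from hm)
      omega
  rw [macaulayBound, hk]

lemma exists_choose_bracket {n d : ℕ} (hd : 1 ≤ d) :
    ∃ k, k.choose d ≤ n ∧ n < (k + 1).choose d := by
  have hub : ∃ k, n < (k + 1).choose d := by
    refine ⟨n + d, ?_⟩
    obtain ⟨d, rfl⟩ : ∃ m, d = m + 1 := ⟨d - 1, by omega⟩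
    rw [Nat.choose_symm_of_eq_add (show n + (d+1) + 1 = (d + 1) + (n + 1) by omega)]
    have h5 : (n + 1 + 1).choose (n + 1) ≤ (n + (d + 1) + 1).choose (n + 1) :=
          Nat.choose_le_choose _ (by omega)
    rw [Nat.choose_succ_self_right] at h5
    omega
  classical
  refine ⟨Nat.find hub, ?_, Nat.find_spec hub⟩
  rcases Nat.eq_zero_or_pos (Nat.find hub) with h | h
  · rw [h, Nat.choose_eq_zero_of_lt (by omega)]; omega
  · have := Nat.find_min hub (show Nat.find hub - 1 < Nat.find hub by omega)
    rw [Nat.sub_add_cancel h] at this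
    omega

lemma mb_choose {k d : ℕ} (hd : 1 ≤ d) : macaulayBound (k.choose d) d = (k + 1).choose (d + 1) := by
  rcases lt_or_ge k d with h | h
  · rw [Nat.choose_eq_zero_of_lt h, mb_zero, Nat.choose_eq_zero_of_lt (by omega)]
  · have h0 := Nat.choose_pos h
    rw [mb_step (k := k) h0 le_rfl _ hd, Nat.sub_self, mb_zero, Nat.add_zero]
    obtain ⟨d, rfl⟩ : ∃ m, d = m + 1 := ⟨d - 1, by omega⟩
    rw [Nat.choose_succ_succ']
    have := Nat.choose_pos (show d ≤ k by omega)
    omega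

lemma mb_one (n : ℕ) : macaulayBound n 1 = (n + 1).choose 2 := by
  have := mb_choose (k := n) (d := 1) le_rfl
  simpa using this

/-- The key recursion. -/
lemma mb_rec {k d a : ℕ} (h : a ≤ k.choose d) (hd : 1 ≤ d ∨ a = 0) :
    macaulayBound (k.choose (d + 1) + a) (d + 1) = (k + 1).choose (d + 2) + macaulayBound a d := by
  rcases Nat.eq_zero_or_pos a with rfl | ha
  · rw [Nat.add_zero, mb_choose (by omega), mb_zero]
    rfl
  have hd1 : 1 ≤ d := by omega
  rcases h.lt_or_eq with h | h
  · rw [mb_step (k := k) (by omega) (by omega) (by rw [Nat.choose_succ_succ']; omega) (by omega)]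
    simp
  · rw [h, mb_choose hd1, show k.choose (d + 1) + k.choose d = (k + 1).choose (d + 1) by
      rw [Nat.choose_succ_succ']; omega, mb_choose (by omega), Nat.choose_succ_succ' (k + 1) (d + 1)]
    exact Nat.add_comm _ _

lemma mb_lt_succ (d n : ℕ) (hd : 1 ≤ d) : macaulayBound n d < macaulayBound (n + 1) d := by
  induction d, hd using Nat.le_induction generalizing n with
  | base =>
    rw [mb_one, mb_one, Nat.choose_succ_succ' (n + 1) 1]
    simp
  | succ d hd ih =>
    obtain ⟨k, h1, h2⟩ := exists_choose_bracket (n := n) (d := d + 1) (by omega)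
    rw [Nat.choose_succ_succ'] at h2
    obtain ⟨a, rfl⟩ := Nat.exists_eq_add_of_le h1
    rw [mb_rec (by omega) (.inl hd), add_assoc, mb_rec (by omega) (.inl hd)]
    have := ih a
    omega

lemma mb_strictMono {d : ℕ} (hd : 1 ≤ d) : StrictMono (fun n => macaulayBound n d) :=
  strictMono_nat_of_lt_succ fun n => mb_lt_succ d n hd

lemma mb_mono {d a b : ℕ} (hd : 1 ≤ d) (h : a ≤ b) : macaulayBound a d ≤ macaulayBound b d :=
  (mb_strictMono hd).monotone h

lemma mb_add_le {d a c : ℕ} (hd : 1 ≤ d) :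
    macaulayBound a d + c ≤ macaulayBound (a + c) d := by
  induction c with
  | zero => simp
  | succ c ih =>
    have := mb_lt_succ d (a + c) hd
    rw [← add_assoc]
    rw [← add_assoc]
    omega

lemma mb_multichoose {r d : ℕ} (hr : 1 ≤ r) (hd : 1 ≤ d) :
    macaulayBound (r.multichoose d) d = r.multichoose (d + 1) := by
  rw [Nat.multichoose_eq, Nat.multichoose_eq, mb_choose hd]
  congr 1
  omega

end Part1

section Part2

/-! ### Kruskal–Katona extremal predicate -/

open Finset Finset.Colex
open scoped FinsetFamily

/-- There is a family of at least `N` sets of size `d + 1` whose shadow has at most `c` members. -/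
def Kap (d c N : ℕ) : Prop :=
  ∃ (n : ℕ) (E : Finset (Finset (Fin n))), (E : Set (Finset (Fin n))).Sized (d + 1) ∧
    #(∂ E) ≤ c ∧ N ≤ #E

lemma Kap.mono {d c N c' N' : ℕ} (h : Kap d c N) (hc : c ≤ c') (hN : N' ≤ N) : Kap d c' N' := by
  obtain ⟨n, E, h1, h2, h3⟩ := h
  exact ⟨n, E, h1, h2.trans hc, hN.trans h3⟩

lemma exists_isInitSeg (n r m : ℕ) (hm : m ≤ n.choose r) :
    ∃ C : Finset (Finset (Fin n)), IsInitSeg C r ∧ #C = m := by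
  obtain ⟨j, hj⟩ := Nat.exists_eq_add_of_le hm
  induction j generalizing m with
  | zero =>
    refine ⟨powersetCard r univ, ⟨Set.sized_powersetCard _ _, ?_⟩, ?_⟩
    · intro s t _ ht
      simp [mem_powersetCard, ht.2]
    · simp [hj]
  | succ j ih =>
    obtain ⟨C, hC, hCc⟩ := ih (m + 1) (by omega) (by omega)
    have hne : C.Nonempty := card_pos.1 (by omega)
    obtain ⟨s, hs, hmax⟩ := exists_max_image C (fun s => toColex s) hne
    refine ⟨C.erase s, ⟨?_, ?_⟩, ?_⟩
    · intro t ht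
      exact hC.1 (mem_of_mem_erase ht)
    · intro t u ht hu
      have h1 := hmax t (mem_of_mem_erase ht)
      refine mem_erase.2 ⟨?_, hC.2 (mem_of_mem_erase ht) hu⟩
      rintro rfl
      exact absurd hu.1 (not_lt.2 h1)
    · rw [card_erase_of_mem hs]; omega

lemma IsInitSeg.subset_of_card_le {n r : ℕ} {A B : Finset (Finset (Fin n))}
    (hA : IsInitSeg A r) (hB : IsInitSeg B r) (h : #A ≤ #B) : A ⊆ B := by
  rcases hA.total hB with h1 | h1
  · exact h1
  · exact (eq_of_subset_of_card_le h1 h).symm.subset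

/-- Sending a set family in `Fin n` to `Fin m`. -/
lemma shadow_map_card_le {n m : ℕ} (f : Fin n ↪ Fin m) (E : Finset (Finset (Fin n))) :
    #(∂ (E.map (mapEmbedding f).toEmbedding)) ≤ #(∂ E) := by
  rw [← card_map (mapEmbedding f).toEmbedding (s := ∂ E)]
  apply card_le_card
  intro t ht
  rw [mem_shadow_iff] at ht
  obtain ⟨s, hs, a, ha, rfl⟩ := ht
  rw [mem_map] at hs
  obtain ⟨s, hs, rfl⟩ := hs
  simp only [RelEmbedding.coe_toEmbedding, mapEmbedding_apply, mem_map] at ha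
  obtain ⟨x, hx, rfl⟩ := ha
  rw [mem_map]
  refine ⟨s.erase x, erase_mem_shadow hs hx, ?_⟩
  simp [map_erase]

lemma Kap.exists_initSeg {d c N : ℕ} (h : Kap d c N) :
    ∃ n0, ∀ n, n0 ≤ n → ∃ C : Finset (Finset (Fin n)), IsInitSeg C (d + 1) ∧ #(∂ C) ≤ c ∧ #C = N := by
  obtain ⟨n0, E, h1, h2, h3⟩ := h
  refine ⟨n0, fun n hn => ?_⟩
  let f : Fin n0 ↪ Fin n := Fin.castLEEmb hn
  let E' := E.map (mapEmbedding f).toEmbedding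
  have hE' : (E' : Set (Finset (Fin n))).Sized (d + 1) := by
    intro s hs
    simp only [E', coe_map, Set.mem_image, mem_coe] at hs
    obtain ⟨t, ht, rfl⟩ := hs
    simpa using h1 ht
  have hc : #E' = #E := card_map _
  have hle : #E' ≤ n.choose (d + 1) := by
    simpa using hE'.card_le
  obtain ⟨C, hC, hCN⟩ := exists_isInitSeg n (d + 1) N (by omega)
  exact ⟨C, hC, (kruskal_katona hE' (by omega) hC).trans ((shadow_map_card_le f E).trans h2), hCN⟩

lemma Kap.glue {d a b p q : ℕ} (h1 : Kap (d + 1) a p) (h2 : Kap d b q) (hq : q ≤ a) :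
    Kap (d + 1) (a + b) (p + q) := by
  obtain ⟨n1, h1⟩ := h1.exists_initSeg
  obtain ⟨n2, h2⟩ := h2.exists_initSeg
  obtain ⟨k, -, hk⟩ := exists_choose_bracket (n := a) (d := d + 1) (by omega)
  let n := n1 + n2 + (k + 1)
  obtain ⟨E0, hE0, hE0s, hE0c⟩ := h1 n (by omega)
  obtain ⟨E1, hE1, hE1s, hE1c⟩ := h2 n (by omega)
  have hch : (k + 1).choose (d + 1) ≤ n.choose (d + 1) := Nat.choose_le_choose _ (by omega)
  obtain ⟨D, hD, hDc⟩ := exists_isInitSeg n (d + 1) a (by omega)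
  have hs : ∂ E0 ⊆ D := IsInitSeg.subset_of_card_le hE0.shadow hD (by omega)
  have hs1 : E1 ⊆ D := IsInitSeg.subset_of_card_le hE1 hD (by omega)
  let σ : Finset (Fin n) → Finset (Fin (n + 1)) := fun s => s.map Fin.castSuccEmb
  let τ : Finset (Fin n) → Finset (Fin (n + 1)) := fun s => insert (Fin.last n) (σ s)
  have hl : ∀ s, Fin.last n ∉ σ s := by
    intro s hs
    simp only [σ, mem_map] at hs
    obtain ⟨x, -, hx⟩ := hs
    exact absurd hx (Fin.castSucc_lt_last x).ne
  have hσ : Function.Injective σ := map_injective _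
  have hτ : Function.Injective τ := by
    intro s t hst
    apply hσ
    have := congrArg (fun u => u.erase (Fin.last n)) hst
    simpa [τ, erase_insert (hl _)] using this
  have hσe : ∀ s x, (σ s).erase (Fin.castSuccEmb x) = σ (s.erase x) := by
    intro s x; simp only [σ]; rw [map_erase]
  have hdisj : Disjoint (E0.image σ) (E1.image τ) := by
    rw [disjoint_left]
    intro t ht ht'
    simp only [mem_image] at ht ht'
    obtain ⟨s, -, rfl⟩ := ht
    obtain ⟨u, -, hu⟩ := ht'
    exact hl s (hu ▸ mem_insert_self _ _)
  refine ⟨n + 1, E0.image σ ∪ E1.image τ, ?_, ?_, ?_⟩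
  · intro t ht
    simp only [coe_union, coe_image, Set.mem_union, Set.mem_image, mem_coe] at ht
    rcases ht with ⟨s, hs, rfl⟩ | ⟨s, hs, rfl⟩
    · simpa [σ] using hE0.1 hs
    · rw [card_insert_of_notMem (hl s)]
      simpa [σ] using hE1.1 hs
  · have hsub : ∂ (E0.image σ ∪ E1.image τ) ⊆ D.image σ ∪ (∂ E1).image τ := by
      intro t ht
      rw [mem_shadow_iff] at ht
      obtain ⟨s, hs', x, hx, rfl⟩ := ht
      simp only [mem_union, mem_image] at hs' ⊢
      rcases hs' with ⟨s, hs', rfl⟩ | ⟨s, hs', rfl⟩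
      · obtain ⟨y, hy, rfl⟩ := mem_map.1 hx
        left
        exact ⟨s.erase y, hs (erase_mem_shadow hs' hy), (hσe s y).symm⟩
      · rcases mem_insert.1 hx with rfl | hx
        · left
          exact ⟨s, hs1 hs', by simp [τ, erase_insert (hl s)]⟩
        · obtain ⟨y, hy, rfl⟩ := mem_map.1 hx
          right
          refine ⟨s.erase y, erase_mem_shadow hs' hy, ?_⟩
          have hne : Fin.last n ≠ Fin.castSuccEmb y := (Fin.castSucc_lt_last y).ne'
          simp only [τ]
          rw [erase_insert_of_ne hne, hσe]
    calc _ ≤ #(D.image σ ∪ (∂ E1).image τ) := card_le_card hsub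
      _ ≤ #(D.image σ) + #((∂ E1).image τ) := card_union_le _ _
      _ ≤ #D + #(∂ E1) := add_le_add card_image_le card_image_le
      _ ≤ a + b := by omega
  · rw [card_union_of_disjoint hdisj, card_image_of_injective _ hσ, card_image_of_injective _ hτ]
    omega

/-- Size recursion for initial segments. -/
lemma card_initSeg_insert {n : ℕ} (s : Finset (Fin n)) (a : Fin n) (ha : ∀ x ∈ s, x < a) :
    #(initSeg (insert a s)) = (a : ℕ).choose (#s + 1) + #(initSeg s) := by
  have has : a ∉ s := fun h => lt_irrefl _ (ha a h)
  have h1 : initSeg (insert a s) = powersetCard (#s + 1) (Iio a) ∪ (initSeg s).image (insert a) := by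
    ext t
    simp only [mem_initSeg, mem_union, mem_powersetCard, mem_image, card_insert_of_notMem has]
    constructor
    · rintro ⟨hc, hle⟩
      have hta : ∀ b ∈ t, b ≤ a := forall_le_mono hle (by
        intro b hb
        rcases mem_insert.1 hb with rfl | hb
        · exact le_rfl
        · exact (ha b hb).le)
      by_cases hat : a ∈ t
      · right
        refine ⟨t.erase a, ⟨?_, ?_⟩, insert_erase hat⟩
        · rw [card_erase_of_mem hat]; omega
        · have := (toColex_sdiff_le_toColex_sdiff (u := {a}) (s := t) (t := insert a s)
            (by simpa) (by simp)).2 hle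
          rwa [sdiff_singleton_eq_erase, sdiff_singleton_eq_erase, erase_insert has] at this
      · left
        refine ⟨fun b hb => mem_Iio.2 (lt_of_le_of_ne (hta b hb) ?_), hc.symm⟩
        rintro rfl; exact hat hb
    · rintro (⟨h1, h2⟩ | ⟨u, ⟨h1, h2⟩, rfl⟩)
      · refine ⟨h2.symm, ?_⟩
        have : toColex t < toColex {a} := toColex_lt_singleton.2 fun b hb => mem_Iio.1 (h1 hb)
        exact this.le.trans (toColex_le_toColex_of_subset (by simp))
      · have hua : a ∉ u := fun h => lt_irrefl _ (forall_lt_mono h2 ha a h)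
        refine ⟨by rw [card_insert_of_notMem hua]; omega, ?_⟩
        rw [← toColex_sdiff_le_toColex_sdiff (u := {a}) (by simp) (by simp),
          sdiff_singleton_eq_erase, sdiff_singleton_eq_erase, erase_insert has, erase_insert hua]
        exact h2
  have hnot : ∀ u ∈ initSeg s, a ∉ u := fun u hu h =>
    lt_irrefl _ (forall_lt_mono (mem_initSeg.1 hu).2 ha a h)
  rw [h1, card_union_of_disjoint, card_powersetCard, Fin.card_Iio, card_image_of_injOn]
  · intro u hu v hv huv
    have := congrArg (fun w => w.erase a) huv
    simpa [erase_insert (hnot u hu), erase_insert (hnot v hv)] using this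
  · rw [disjoint_left]
    intro t ht ht'
    obtain ⟨u, -, rfl⟩ := mem_image.1 ht'
    exact lt_irrefl _ (mem_Iio.1 ((mem_powersetCard.1 ht).1 (mem_insert_self a u)))

lemma card_initSeg_le {n : ℕ} (s : Finset (Fin n)) (a : Fin n) (ha : ∀ x ∈ s, x < a) :
    #(initSeg s) ≤ (a : ℕ).choose #s := by
  rw [← Fin.card_Iio a, ← card_powersetCard]
  apply card_le_card
  intro t ht
  rw [mem_initSeg] at ht
  exact mem_powersetCard.2 ⟨fun b hb => mem_Iio.2 (forall_lt_mono ht.2 ha b hb), ht.1.symm⟩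

lemma card_initSeg_empty {n : ℕ} : #(initSeg (∅ : Finset (Fin n))) = 1 := by
  rw [card_eq_one]
  refine ⟨∅, ?_⟩
  ext t
  simp only [mem_initSeg, mem_singleton, card_empty]
  constructor
  · rintro ⟨h, -⟩; exact card_eq_zero.1 h.symm
  · rintro rfl; simp

lemma initSeg_bound {n : ℕ} (s : Finset (Fin n)) :
    ∀ (hs : s.Nonempty), 2 ≤ #s →
    #(initSeg s) + #(initSeg (s.erase (s.min' hs))) ≤
      macaulayBound #(initSeg (s.erase (s.min' hs))) (#s - 1) := by
  induction s using Finset.induction_on_max with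
  | empty => intro h; simp at h
  | insert a s ha ih =>
    intro hne hc
    have has : a ∉ s := fun h => lt_irrefl _ (ha a h)
    rw [card_insert_of_notMem has] at hc ⊢
    have hsn : s.Nonempty := card_pos.1 (by omega)
    have hmin : (insert a s).min' hne = s.min' hsn := by
      rw [min'_insert _ _ hsn, min_eq_right]
      exact (ha _ (min'_mem _ _)).le
    have hma : a ≠ s.min' hsn := (ha _ (min'_mem _ _)).ne'
    rw [hmin, erase_insert_of_ne hma]
    have ha' : ∀ x ∈ s.erase (s.min' hsn), x < a := fun x hx => ha x (mem_of_mem_erase hx)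
    rw [card_initSeg_insert s a ha, card_initSeg_insert _ a ha', card_erase_of_mem (min'_mem _ _)]
    have hle := card_initSeg_le _ a ha'
    rw [card_erase_of_mem (min'_mem _ _)] at hle
    obtain ⟨d, hd⟩ : ∃ d, #s = d + 1 := ⟨#s - 1, by omega⟩
    rw [hd] at hle ⊢
    simp only [Nat.add_sub_cancel] at hle ⊢
    rcases Nat.eq_zero_or_pos d with rfl | hdp
    · obtain ⟨b, rfl⟩ := card_eq_one.1 hd
      have hba : b < a := ha b (by simp)
      have hb : #(initSeg ({b} : Finset (Fin n))) = b + 1 := by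
        have := card_initSeg_insert (∅ : Finset (Fin n)) b (by simp)
        simpa [card_initSeg_empty] using this
      simp only [min'_singleton]
      have he : ({b} : Finset (Fin n)).erase b = ∅ := by simp
      rw [he, hb, card_initSeg_empty, mb_one]
      have hv : (b : ℕ) < a := hba
      simp only [Nat.zero_add, Nat.choose_one_right]
      have e1 : ((a : ℕ) + 1 + 1).choose 2 = (a : ℕ).choose 2 + a + a + 1 := by
        rw [Nat.choose_succ_succ' _ 1, Nat.choose_succ_succ' _ 1]; simp; omega
      have e3 : (a : ℕ).choose 2 = (a : ℕ).choose (1 + 1) := rfl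
      rw [e1]
      omega
    · rw [mb_rec hle (.inl hdp)]
      have := ih hsn (by omega)
      rw [hd, Nat.add_sub_cancel] at this
      have e := Nat.choose_succ_succ' (a : ℕ) (d + 1)
      have e2 : ((a : ℕ) + 1).choose (d + 2) = ((a : ℕ) + 1).choose (d + 1 + 1) := rfl
      omega

lemma Kap.bound {d c N : ℕ} (hd : 1 ≤ d) (h : Kap d c N) : c + N ≤ macaulayBound c d := by
  obtain ⟨n, h⟩ := h.exists_initSeg
  obtain ⟨C, hC, hs, rfl⟩ := h n le_rfl
  rcases C.eq_empty_or_nonempty with rfl | hne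
  · have := mb_add_le (d := d) (a := 0) (c := c) hd
    simp only [mb_zero, Nat.zero_add] at this
    simpa using this
  · obtain ⟨s, hsc, rfl⟩ := hC.exists_initSeg hne
    have hsn : s.Nonempty := card_pos.1 (by omega)
    have hb := initSeg_bound s hsn (by omega)
    rw [shadow_initSeg hsn] at hs
    rw [hsc, Nat.add_sub_cancel] at hb
    obtain ⟨j, rfl⟩ := Nat.exists_eq_add_of_le hs
    have := mb_add_le (d := d) (a := #(initSeg (s.erase (s.min' hsn)))) (c := j) hd
    omega

end Part2

section Part3

/-! ### Macaulay's upper bound for monomials -/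

open Finset
open scoped FinsetFamily

lemma monDeg_add_single {r : ℕ} (N : Fin r → ℕ) (j : Fin r) :
    monDeg (N + Pi.single j 1) = monDeg N + 1 := by
  simp [monDeg, sum_add_distrib]

lemma monDeg_cons {r : ℕ} (t : ℕ) (N : Fin r → ℕ) :
    monDeg (Fin.cons t N : Fin (r + 1) → ℕ) = t + monDeg N := by
  simp [monDeg, Fin.sum_univ_succ]

lemma exists_eq_add_single {r : ℕ} (M : Fin r → ℕ) (j : Fin r) (h : M j ≠ 0) :
    ∃ N : Fin r → ℕ, M = N + Pi.single j 1 := by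
  refine ⟨M - Pi.single j 1, ?_⟩
  ext k
  by_cases hk : k = j
  · subst hk; simp; omega
  · simp [hk]

lemma exists_pos_of_monDeg {r : ℕ} (M : Fin r → ℕ) (h : monDeg M ≠ 0) : ∃ j, M j ≠ 0 := by
  by_contra hc
  push Not at hc
  exact h (by simp [monDeg, hc])

lemma kap_zero (N : ℕ) : Kap 0 1 N := by
  refine ⟨N, (univ : Finset (Fin N)).image (fun x => {x}), ?_, ?_, ?_⟩
  · intro s hs
    simp only [coe_image, Set.mem_image] at hs
    obtain ⟨x, -, rfl⟩ := hs
    simp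
  · have : ∂ ((univ : Finset (Fin N)).image (fun x => ({x} : Finset (Fin N)))) ⊆ {∅} := by
      intro t ht
      rw [mem_shadow_iff] at ht
      obtain ⟨s, hs, a, ha, rfl⟩ := ht
      obtain ⟨x, -, rfl⟩ := mem_image.1 hs
      simp at ha
      simp [ha]
    simpa using card_le_card this
  · rw [card_image_of_injective _ singleton_injective]; simp

lemma kap_empty (d : ℕ) : Kap d 0 0 := ⟨0, ∅, by simp [Set.Sized], by simp, by simp⟩

/-- Slicing a set of monomials along the first variable. -/
lemma card_slice {r : ℕ} (C : Finset (Fin (r + 1) → ℕ)) :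
    ∃ (C0 : Finset (Fin r → ℕ)) (C1 : Finset (Fin (r + 1) → ℕ)),
      (∀ N, N ∈ C0 ↔ (Fin.cons 0 N : Fin (r + 1) → ℕ) ∈ C) ∧
      (∀ N, N ∈ C1 ↔ N + Pi.single 0 1 ∈ C) ∧ #C = #C0 + #C1 := by
  classical
  refine ⟨(C.filter fun M => M 0 = 0).image Fin.tail,
    (C.filter fun M => ¬ M 0 = 0).image (fun M => M - Pi.single 0 1), ?_, ?_, ?_⟩
  · intro N
    simp only [mem_image, mem_filter]
    constructor
    · rintro ⟨M, ⟨hM, h0⟩, rfl⟩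
      rw [← h0, Fin.cons_self_tail]; exact hM
    · intro h
      exact ⟨_, ⟨h, by simp⟩, by simp⟩
  · intro N
    simp only [mem_image, mem_filter]
    constructor
    · rintro ⟨M, ⟨hM, h0⟩, rfl⟩
      obtain ⟨N, rfl⟩ := exists_eq_add_single M 0 h0
      simpa using hM
    · intro h
      exact ⟨_, ⟨h, by simp⟩, by simp⟩
  · rw [card_image_of_injOn, card_image_of_injOn, card_filter_add_card_filter_not]
    · intro M hM M' hM' h
      simp only [coe_filter, Set.mem_ofPred_eq] at hM hM'
      obtain ⟨N, rfl⟩ := exists_eq_add_single M 0 hM.2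
      obtain ⟨N', rfl⟩ := exists_eq_add_single M' 0 hM'.2
      simp only [add_tsub_cancel_right] at h
      rw [h]
    · intro M hM M' hM' h
      simp only [coe_filter, Set.mem_ofPred_eq] at hM hM'
      rw [← Fin.cons_self_tail M, ← Fin.cons_self_tail M', h, hM.2, hM'.2]

lemma kap_of_monomials (r : ℕ) : ∀ (d : ℕ) (C B : Finset (Fin r → ℕ)),
    (∀ M ∈ C, monDeg M = d) → (∀ M ∈ B, monDeg M = d + 1) →
    (∀ N j, N + Pi.single j 1 ∈ B → N ∈ C) → Kap d #C (#B - #C) := by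
  induction r with
  | zero =>
    intro d C B hC hB h
    have : B = ∅ := by
      rw [eq_empty_iff_forall_notMem]
      intro M hM
      have := hB M hM
      simp [monDeg] at this
    subst this
    exact (kap_empty d).mono (by simp) (by simp)
  | succ r ihr =>
    intro d
    induction d with
    | zero =>
      intro C B hC hB h
      rcases C.eq_empty_or_nonempty with rfl | hne
      · have : B = ∅ := by
          rw [eq_empty_iff_forall_notMem]
          intro M hM
          obtain ⟨j, hj⟩ := exists_pos_of_monDeg M (by rw [hB M hM]; omega)
          obtain ⟨N, rfl⟩ := exists_eq_add_single M j hj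
          simpa using h N j hM
        subst this
        exact (kap_empty 0).mono (by simp) (by simp)
      · exact (kap_zero _).mono (card_pos.2 hne) le_rfl
    | succ d ihd =>
      intro C B hC hB h
      obtain ⟨C0, C1, hC0, hC1, hCc⟩ := card_slice C
      obtain ⟨B0, B1, hB0, hB1, hBc⟩ := card_slice B
      have h0 : Kap (d + 1) #C0 (#B0 - #C0) := by
        refine ihr (d + 1) C0 B0 ?_ ?_ ?_
        · intro M hM
          have := hC _ ((hC0 M).1 hM)
          rwa [monDeg_cons, Nat.zero_add] at this
        · intro M hM
          have := hB _ ((hB0 M).1 hM)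
          rwa [monDeg_cons, Nat.zero_add] at this
        · intro N j hN
          rw [hC0]
          apply h _ j.succ
          rw [hB0] at hN
          convert hN using 1
          ext k
          refine Fin.cases ?_ (fun k => ?_) k
          · simp [Pi.single_apply, (Fin.succ_ne_zero j).symm]
          · simp [Pi.single_apply]
      have h1 : Kap d #C1 (#B1 - #C1) := by
        refine ihd C1 B1 ?_ ?_ ?_
        · intro M hM
          have := hC _ ((hC1 M).1 hM)
          rw [monDeg_add_single] at this
          omega
        · intro M hM
          have := hB _ ((hB1 M).1 hM)
          rw [monDeg_add_single] at this
          omega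
        · intro N j hN
          rw [hC1]
          apply h _ j
          rw [hB1] at hN
          rwa [add_right_comm]
      have hsub : B1 ⊆ C := fun N hN => h N 0 ((hB1 N).1 hN)
      have hcard := card_le_card hsub
      exact (h0.glue h1 (by omega)).mono (by omega) (by omega)

/-- Macaulay's bound for monomials. -/
lemma macaulay_monomials {r d : ℕ} (hd : 1 ≤ d) (C B : Finset (Fin r → ℕ))
    (hC : ∀ M ∈ C, monDeg M = d) (hB : ∀ M ∈ B, monDeg M = d + 1)
    (h : ∀ N j, N + Pi.single j 1 ∈ B → N ∈ C) : #B ≤ macaulayBound #C d := by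
  have := (kap_of_monomials r d C B hC hB h).bound hd
  omega

end Part3

section Part4

/-! ### Lex segments: existence of order ideals -/

open Finset

/-- Rank of a monomial among the monomials of its degree. -/
def rk : (m : ℕ) → (Fin m → ℕ) → ℕ
  | 0, _ => 0
  | (m + 1), M => rk m (Fin.tail M) +
      ∑ u ∈ range (M 0), Nat.multichoose m (monDeg (Fin.tail M) + u + 1)

lemma rk_cons_zero {m : ℕ} (N : Fin m → ℕ) :
    rk (m + 1) (Fin.cons 0 N) = rk m N := by
  simp [rk]

lemma monDeg_eq_tail {m : ℕ} (N : Fin (m + 1) → ℕ) : monDeg N = N 0 + monDeg (Fin.tail N) := by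
  rw [← monDeg_cons, Fin.cons_self_tail]

lemma tail_add_single {m : ℕ} (N : Fin (m + 1) → ℕ) :
    Fin.tail (N + Pi.single 0 1) = Fin.tail N := by
  ext k
  simp [Fin.tail]

lemma rk_add_single {m : ℕ} (N : Fin (m + 1) → ℕ) :
    rk (m + 1) (N + Pi.single 0 1) = rk (m + 1) N + Nat.multichoose m (monDeg N + 1) := by
  rw [monDeg_eq_tail]
  simp only [rk, tail_add_single]
  simp only [Pi.add_apply, Pi.single_eq_same, sum_range_succ]
  rw [Nat.add_comm (N 0)]
  omega

/-- Induction along the first variable. -/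
lemma cons_ind {m : ℕ} {p : (Fin (m + 1) → ℕ) → Prop} (h0 : ∀ N, p (Fin.cons 0 N))
    (h1 : ∀ N, p N → p (N + Pi.single 0 1)) (M : Fin (m + 1) → ℕ) : p M := by
  induction ht : M 0 generalizing M with
  | zero => rw [← Fin.cons_self_tail M, ht]; exact h0 _
  | succ t ih =>
    obtain ⟨N, rfl⟩ := exists_eq_add_single M 0 (by omega)
    refine h1 _ (ih _ ?_)
    simpa using ht

lemma mc_succ (m d : ℕ) :
    Nat.multichoose (m + 1) (d + 1) = Nat.multichoose m (d + 1) + Nat.multichoose (m + 1) d :=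
  Nat.multichoose_succ_succ _ _

lemma mc_le_succ (m d : ℕ) : Nat.multichoose m d ≤ Nat.multichoose (m + 1) d := by
  cases d with
  | zero => simp
  | succ d => rw [mc_succ]; omega

lemma rk_lt (m : ℕ) : ∀ M : Fin m → ℕ, rk m M < Nat.multichoose m (monDeg M) := by
  induction m with
  | zero => intro M; simp [rk, monDeg]
  | succ m ih =>
    intro M
    induction M using cons_ind with
    | h0 N =>
      rw [rk_cons_zero, monDeg_cons, Nat.zero_add]
      exact (ih N).trans_le (mc_le_succ _ _)
    | h1 N h =>
      rw [rk_add_single, monDeg_add_single, mc_succ]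
      omega

lemma rk_surj (m : ℕ) : ∀ d n, n < Nat.multichoose m d → ∃ M : Fin m → ℕ, monDeg M = d ∧ rk m M = n := by
  induction m with
  | zero =>
    intro d n h
    cases d with
    | zero => exact ⟨0, by simp [monDeg], by simp at h; simp [rk, h]⟩
    | succ d => simp at h
  | succ m ih =>
    intro d
    induction d with
    | zero =>
      intro n h
      simp at h
      obtain ⟨M, h1, h2⟩ := ih 0 0 (by simp)
      exact ⟨Fin.cons 0 M, by rw [monDeg_cons, h1], by rw [rk_cons_zero, h2, h]⟩
    | succ d ihd =>
      intro n h
      by_cases hn : n < Nat.multichoose m (d + 1)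
      · obtain ⟨M, h1, h2⟩ := ih _ n hn
        exact ⟨Fin.cons 0 M, by rw [monDeg_cons, h1]; omega, by rw [rk_cons_zero, h2]⟩
      · rw [mc_succ] at h
        obtain ⟨M, h1, h2⟩ := ihd (n - Nat.multichoose m (d + 1)) (by omega)
        exact ⟨M + Pi.single 0 1, by rw [monDeg_add_single, h1], by
          rw [rk_add_single, h1, h2]; omega⟩

lemma rk_inj (m : ℕ) : ∀ M M' : Fin m → ℕ, monDeg M = monDeg M' → rk m M = rk m M' → M = M' := by
  induction m with
  | zero => intro M M' _ _; exact Subsingleton.elim _ _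
  | succ m ih =>
    intro M
    have key : ∀ (N : Fin m → ℕ) (N' : Fin (m + 1) → ℕ),
        monDeg (Fin.cons 0 N : Fin (m + 1) → ℕ) = monDeg (N' + Pi.single 0 1) →
        rk (m + 1) (Fin.cons 0 N) = rk (m + 1) (N' + Pi.single 0 1) → False := by
      intro N N' h1 h2
      rw [monDeg_cons, monDeg_add_single] at h1
      rw [rk_cons_zero, rk_add_single] at h2
      have := rk_lt m N
      rw [Nat.zero_add] at h1
      rw [h1] at this
      omega
    induction M using cons_ind with
    | h0 N =>
      intro M'
      induction M' using cons_ind with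
      | h0 N' =>
        intro h1 h2
        rw [monDeg_cons, monDeg_cons] at h1
        rw [rk_cons_zero, rk_cons_zero] at h2
        rw [ih N N' (by omega) h2]
      | h1 N' _ => intro h1 h2; exact (key _ _ h1 h2).elim
    | h1 N hN =>
      intro M'
      induction M' using cons_ind with
      | h0 N' => intro h1 h2; exact (key _ _ h1.symm h2.symm).elim
      | h1 N' _ =>
        intro h1 h2
        rw [monDeg_add_single, monDeg_add_single] at h1
        rw [rk_add_single, rk_add_single] at h2
        have h3 : monDeg N = monDeg N' := by omega
        rw [h3] at h2
        rw [hN N' h3 (by omega)]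

lemma rk_shadow (m : ℕ) : ∀ (N : Fin m → ℕ) (j : Fin m),
    macaulayBound (rk m N) (monDeg N) ≤ rk m (N + Pi.single j 1) := by
  induction m with
  | zero => intro N j; exact j.elim0
  | succ m ih =>
    intro N
    induction N using cons_ind with
    | h0 N =>
      intro j
      refine Fin.cases ?_ (fun j => ?_) j
      · rw [rk_add_single, rk_cons_zero, monDeg_cons, Nat.zero_add]
        have hlt := rk_lt m N
        by_cases hd : 1 ≤ monDeg N
        · by_cases hm : 1 ≤ m
          · have := mb_mono hd hlt.le
            rw [mb_multichoose hm hd] at this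
            omega
          · obtain rfl : m = 0 := by omega
            simp [rk, mb_zero]
        · have h0 : monDeg N = 0 := by omega
          rw [h0] at hlt
          have h1 : rk m N = 0 := by simpa using hlt
          rw [h1, mb_zero]; omega
      · have : (Fin.cons 0 N : Fin (m + 1) → ℕ) + Pi.single j.succ 1
            = Fin.cons 0 (N + Pi.single j 1) := by
          ext k
          refine Fin.cases ?_ (fun k => ?_) k
          · simp [(Fin.succ_ne_zero j).symm]
          · simp [Pi.single_apply]
        rw [this, rk_cons_zero, rk_cons_zero, monDeg_cons, Nat.zero_add]
        exact ih N j
    | h1 N hN =>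
      intro j
      rw [add_right_comm, rk_add_single, rk_add_single, monDeg_add_single, monDeg_add_single]
      have hlt := rk_lt _ N
      rw [Nat.multichoose_eq, show m + 1 + monDeg N - 1 = m + monDeg N by omega] at hlt
      rw [Nat.multichoose_eq, Nat.multichoose_eq, show m + (monDeg N + 1) - 1 = m + monDeg N by omega,
        show m + (monDeg N + 1 + 1) - 1 = m + monDeg N + 1 by omega, Nat.add_comm (rk (m + 1) N),
        mb_rec hlt.le ?_]
      · have := hN j
        have e : (m + monDeg N + 1).choose (monDeg N + 2)
          = (m + monDeg N + 1).choose (monDeg N + 1 + 1) := rfl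
        omega
      · by_cases hd : 1 ≤ monDeg N
        · exact .inl hd
        · right
          have h0 : monDeg N = 0 := by omega
          rw [h0] at hlt
          simpa using hlt

/-- Monomials of bounded degree form a finite set. -/
noncomputable def boundedMon (m d : ℕ) : Finset (Fin m → ℕ) :=
  (Fintype.piFinset fun _ => range (d + 1)).filter fun M => monDeg M ≤ d

lemma le_monDeg {m : ℕ} (M : Fin m → ℕ) (j : Fin m) : M j ≤ monDeg M :=
  single_le_sum (fun _ _ => Nat.zero_le _) (mem_univ j)

lemma mem_boundedMon {m d : ℕ} (M : Fin m → ℕ) : M ∈ boundedMon m d ↔ monDeg M ≤ d := by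
  simp only [boundedMon, mem_filter, Fintype.mem_piFinset, mem_range, and_iff_right_iff_imp]
  intro h j
  have := le_monDeg M j
  omega

/-- Closure under removing one variable at a time gives closure under divisibility. -/
lemma closed_of_step {m : ℕ} (p : (Fin m → ℕ) → Prop)
    (h : ∀ N j, p (N + Pi.single j 1) → p N) (M N : Fin m → ℕ) (hN : ∀ j, N j ≤ M j)
    (hM : p M) : p N := by
  induction hk : monDeg M - monDeg N generalizing M with
  | zero =>
    have hle : monDeg M ≤ monDeg N := by omega
    have : N = M := by
      ext j
      by_contra hne
      have : monDeg N < monDeg M :=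
        sum_lt_sum (fun i _ => hN i) ⟨j, mem_univ j, by have := hN j; omega⟩
      omega
    rwa [this]
  | succ k ih =>
    have : ∃ j, N j < M j := by
      by_contra hc
      push Not at hc
      have : monDeg M ≤ monDeg N := sum_le_sum fun i _ => hc i
      omega
    obtain ⟨j, hj⟩ := this
    obtain ⟨L, rfl⟩ := exists_eq_add_single M j (by omega)
    refine ih L ?_ (h _ _ hM) ?_
    · intro i
      by_cases hi : i = j
      · subst hi; simp at hj; omega
      · have := hN i; simpa [hi] using this
    · rw [monDeg_add_single] at hk; omega

/-- Macaulay: every sequence satisfying Macaulay's bound is realized by an order ideal. -/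
lemma exists_orderIdeal (g : ℕ → ℕ) (e : ℕ) (g0 : g 0 = 1) (hg : SatisfiesMacaulay g e) :
    ∃ (r : ℕ) (Y : Finset (Fin r → ℕ)), IsOrderIdeal Y ∧ (∀ M ∈ Y, monDeg M ≤ e) ∧
      ∀ i ≤ e, #(Y.filter fun M => monDeg M = i) = g i := by
  classical
  set r := g 1 + 1 with hr
  have hgb : ∀ i, i ≤ e → g i ≤ Nat.multichoose r i := by
    intro i
    induction i with
    | zero => intro _; simp [g0]
    | succ i ih =>
      intro hi
      rcases Nat.eq_zero_or_pos i with rfl | hp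
      · simp [hr]
      · refine (hg i hp hi).trans ?_
        rw [← mb_multichoose (by omega : 1 ≤ r) hp]
        exact mb_mono hp (ih (by omega))
  refine ⟨r, (boundedMon r e).filter fun M => rk r M < g (monDeg M), ⟨⟨0, ?_⟩, ?_⟩, ?_, ?_⟩
  · have h0 : monDeg (0 : Fin r → ℕ) = 0 := by simp [monDeg]
    have := rk_lt r 0
    rw [h0] at this
    simp only [mem_filter, mem_boundedMon, h0, g0]
    simpa using this
  · intro M hM N hN
    refine closed_of_step _ ?_ M N hN hM
    intro N j h
    simp only [mem_filter, mem_boundedMon, monDeg_add_single] at h ⊢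
    refine ⟨by omega, ?_⟩
    by_cases hd : 1 ≤ monDeg N
    · by_contra hc
      have h1 := mb_mono hd (not_lt.1 hc)
      have h2 := rk_shadow r N j
      have h3 := hg _ hd h.1
      omega
    · have h0 : monDeg N = 0 := by omega
      have := rk_lt r N
      rw [h0] at this ⊢
      simpa [g0] using this
  · intro M hM
    exact (mem_boundedMon M).1 (mem_filter.1 hM).1
  · intro i hi
    rw [← card_range (g i)]
    apply card_bij (fun M _ => rk r M)
    · intro M hM
      simp only [mem_filter] at hM
      rw [mem_range, ← hM.2]
      exact hM.1.2
    · intro M hM M' hM' h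
      simp only [mem_filter] at hM hM'
      exact rk_inj r M M' (by rw [hM.2, hM'.2]) h
    · intro n hn
      rw [mem_range] at hn
      obtain ⟨M, h1, h2⟩ := rk_surj r i n (hn.trans_le (hgb i hi))
      refine ⟨M, ?_, h2⟩
      simp only [mem_filter, mem_boundedMon]
      exact ⟨⟨by omega, by rw [h1, h2]; exact hn⟩, h1⟩

/-- The cone over an order ideal truncated in degree `2 e` is pure. -/
lemma exists_pure (h : ℕ → ℕ) (e : ℕ) (hd : IsDifferentiable h e) :
    ∃ g : ℕ → ℕ, IsPureOSeq g (2 * e) ∧ ∀ i ≤ e, g i = h i := by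
  classical
  obtain ⟨h0, hmono, hmac⟩ := hd
  obtain ⟨r, Y, ⟨⟨Y0, hY0⟩, hYc⟩, hYe, hYg⟩ := exists_orderIdeal _ e (by simp) hmac
  set X : Finset (Fin (r + 1) → ℕ) :=
    (boundedMon (r + 1) (2 * e)).filter fun M => Fin.tail M ∈ Y with hX
  have hmem : ∀ M, M ∈ X ↔ monDeg M ≤ 2 * e ∧ Fin.tail M ∈ Y := by
    intro M; simp [hX, mem_boundedMon]
  have hmax : ∀ N ∈ Y, (Fin.cons (2 * e - monDeg N) N : Fin (r + 1) → ℕ) ∈ X ∧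
      monDeg (Fin.cons (2 * e - monDeg N) N : Fin (r + 1) → ℕ) = 2 * e := by
    intro N hN
    have := hYe N hN
    rw [hmem, monDeg_cons, Fin.tail_cons]
    exact ⟨⟨by omega, hN⟩, by omega⟩
  refine ⟨fun i => #(X.filter fun M => monDeg M = i), ⟨r + 1, X, ⟨⟨⟨_, (hmax _ hY0).1⟩, ?_⟩, ?_,
    ⟨_, hmax _ hY0⟩, ?_⟩, fun i _ => rfl⟩, ?_⟩
  · intro M hM N hN
    rw [hmem] at hM ⊢
    refine ⟨(sum_le_sum fun i _ => hN i).trans hM.1, hYc _ hM.2 _ fun j => hN j.succ⟩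
  · intro M hM; exact ((hmem M).1 hM).1
  · rintro M ⟨hM, hmx⟩
    rw [hmem] at hM
    have h1 := hmax _ hM.2
    rw [← h1.2]
    rw [hmx _ h1.1]
    intro j
    refine Fin.cases ?_ (fun j => ?_) j
    · have := monDeg_eq_tail M
      simp; omega
    · simp [Fin.tail]
  · intro i hi
    have hcount : ∀ i ≤ e, #(X.filter fun M => monDeg M = i)
        = #(Y.filter fun M => monDeg M ≤ i) := by
      intro i hi
      apply card_bij (fun M _ => Fin.tail M)
      · intro M hM
        simp only [mem_filter, hmem] at hM ⊢
        have := monDeg_eq_tail M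
        exact ⟨hM.1.2, by omega⟩
      · intro M hM M' hM' ht
        simp only [mem_filter, hmem] at hM hM'
        have e1 := monDeg_eq_tail M
        have e2 := monDeg_eq_tail M'
        rw [← Fin.cons_self_tail M, ← Fin.cons_self_tail M', ht]
        rw [ht] at e1
        rw [show M 0 = M' 0 by omega]
      · intro N hN
        simp only [mem_filter] at hN
        refine ⟨Fin.cons (i - monDeg N) N, ?_, by simp⟩
        simp only [mem_filter, hmem, monDeg_cons, Fin.tail_cons]
        exact ⟨⟨by omega, hN.1⟩, by omega⟩
    show #(X.filter fun M => monDeg M = i) = h i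
    rw [hcount i hi]
    induction i with
    | zero =>
      have := hYg 0 hi
      simp only [Nat.le_zero]
      rw [this, h0]; simp
    | succ i ih =>
      have := hYg (i + 1) hi
      have hs : Y.filter (fun M => monDeg M ≤ i + 1)
          = Y.filter (fun M => monDeg M ≤ i) ∪ Y.filter (fun M => monDeg M = i + 1) := by
        ext M; simp only [mem_filter, mem_union, ← and_or_left]
        refine and_congr_right fun _ => by omega
      rw [hs, card_union_of_disjoint, ih (by omega), this]
      · have := hmono (i + 1) (by omega) hi
        simp at this ⊢
        omega
      · rw [disjoint_left]
        intro M h1 h2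
        simp only [mem_filter] at h1 h2
        omega

end Part4

section Part5

/-! ### The strong Lefschetz-type injectivity for boxes -/

open Finset

/-- Raising operator. -/
def opU {r : ℕ} (f : (Fin r → ℕ) → ℚ) (M : Fin r → ℕ) : ℚ :=
  ∑ j, if M j = 0 then 0 else f (M - Pi.single j 1)

/-- Coefficients of the lowering operator. -/
def cD {r : ℕ} (m : Fin r → ℕ) (j : Fin r) (L : Fin r → ℕ) : ℚ :=
  ((L j : ℚ) + 1) * ((m j : ℚ) - L j)

/-- Lowering operator. -/
def opD {r : ℕ} (m : Fin r → ℕ) (f : (Fin r → ℕ) → ℚ) (L : Fin r → ℕ) : ℚ :=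
  ∑ j, cD m j L * f (L + Pi.single j 1)

/-- Weights. -/
def wt {r : ℕ} (m : Fin r → ℕ) (N : Fin r → ℕ) : ℚ :=
  ∏ j, (((N j).factorial * (m j).descFactorial (N j) : ℕ) : ℚ)

lemma wt_pos {r : ℕ} {m N : Fin r → ℕ} (h : N ≤ m) : 0 < wt m N := by
  refine prod_pos fun j _ => ?_
  have h1 := Nat.factorial_pos (N j)
  have h2 : 0 < (m j).descFactorial (N j) := Nat.descFactorial_pos.2 (h j)
  exact_mod_cast Nat.mul_pos h1 h2

lemma wt_add_single {r : ℕ} {m N : Fin r → ℕ} (h : N ≤ m) (j : Fin r) :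
    wt m (N + Pi.single j 1) = cD m j N * wt m N := by
  unfold wt
  rw [← mul_prod_erase univ _ (mem_univ j), ← mul_prod_erase univ (fun j => (((N j).factorial * (m j).descFactorial (N j) : ℕ) : ℚ)) (mem_univ j),
    ← mul_assoc]
  congr 1
  · simp only [Pi.add_apply, Pi.single_eq_same, Nat.factorial_succ, Nat.descFactorial_succ, cD]
    have := h j
    push_cast [Nat.cast_sub this]
    ring
  · refine prod_congr rfl fun k hk => ?_
    simp [ne_of_mem_erase hk]

lemma op_comm {r : ℕ} (m : Fin r → ℕ) (f : (Fin r → ℕ) → ℚ) (N : Fin r → ℕ) :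
    opD m (opU f) N = opU (opD m f) N + (∑ j, ((m j : ℚ) - 2 * N j)) * f N := by
  have e1 : opD m (opU f) N = ∑ j, ∑ k, cD m j N *
      (if (N + Pi.single j 1 : Fin r → ℕ) k = 0 then 0 else f (N + Pi.single j 1 - Pi.single k 1)) := by
    simp only [opD, opU, mul_sum]
  have e2 : opU (opD m f) N = ∑ j, ∑ k, (if N k = 0 then 0 else
      cD m j (N - Pi.single k 1) * f (N - Pi.single k 1 + Pi.single j 1)) := by
    rw [sum_comm]
    simp only [opD, opU]
    refine sum_congr rfl fun k _ => ?_
    split_ifs <;> simp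
  rw [e1, e2, sum_mul, ← sum_add_distrib]
  refine sum_congr rfl fun j _ => ?_
  have key : ∀ (F G : Fin r → ℚ) (c : ℚ), (∀ k, k ≠ j → F k = G k) → F j = G j + c →
      ∑ k, F k = ∑ k, G k + c := by
    intro F G c h1 h2
    rw [← add_sum_erase univ F (mem_univ j), ← add_sum_erase univ G (mem_univ j), h2,
      sum_congr rfl fun k hk => h1 k (ne_of_mem_erase hk)]
    ring
  apply key
  · intro k hkj
    by_cases h0 : N k = 0
    · simp [h0, hkj]
    · have h1 : ¬ (N + Pi.single j 1 : Fin r → ℕ) k = 0 := by simp [h0]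
      rw [if_neg h1, if_neg h0]
      obtain ⟨L, rfl⟩ := exists_eq_add_single N k h0
      rw [add_right_comm, add_tsub_cancel_right, add_tsub_cancel_right]
      simp [cD, hkj.symm]
  · rw [if_neg (by simp), add_tsub_cancel_right]
    by_cases h0 : N j = 0
    · simp [h0, cD]
    · rw [if_neg h0]
      obtain ⟨L, rfl⟩ := exists_eq_add_single N j h0
      rw [add_tsub_cancel_right]
      simp only [cD, Pi.add_apply, Pi.single_eq_same]
      push_cast
      ring

lemma op_adj {r : ℕ} (m : Fin r → ℕ) (f g : (Fin r → ℕ) → ℚ) :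
    ∑ M ∈ Iic m, wt m M * f M * opU g M = ∑ N ∈ Iic m, wt m N * g N * opD m f N := by
  simp only [opU, opD, mul_sum]
  rw [sum_comm, sum_comm (s := Iic m)]
  refine sum_congr rfl fun j _ => ?_
  have e1 : ∑ M ∈ Iic m, wt m M * f M * (if M j = 0 then 0 else g (M - Pi.single j 1))
      = ∑ M ∈ (Iic m).filter (fun M => ¬ M j = 0), wt m M * f M * g (M - Pi.single j 1) := by
    rw [sum_filter]
    refine sum_congr rfl fun M _ => ?_
    split_ifs <;> simp_all
  have e2 : ∑ N ∈ Iic m, wt m N * g N * (cD m j N * f (N + Pi.single j 1))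
      = ∑ N ∈ (Iic m).filter (fun N => N j < m j),
        wt m N * g N * (cD m j N * f (N + Pi.single j 1)) := by
    rw [sum_filter]
    refine sum_congr rfl fun N hN => ?_
    split_ifs with h
    · rfl
    · have h1 : N j = m j := le_antisymm ((mem_Iic.1 hN) j) (not_lt.1 h)
      simp [cD, h1]
  rw [e1, e2]
  symm
  refine sum_bij (fun N _ => N + Pi.single j 1) ?_ ?_ ?_ ?_
  · intro N hN
    simp only [mem_filter, mem_Iic] at hN ⊢
    refine ⟨fun k => ?_, by simp⟩
    by_cases hk : k = j
    · subst hk; simpa using hN.2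
    · simpa [hk] using hN.1 k
  · intro N _ N' _ h
    exact add_right_cancel h
  · intro M hM
    simp only [mem_filter, mem_Iic] at hM
    obtain ⟨N, rfl⟩ := exists_eq_add_single M j hM.2
    refine ⟨N, ?_, rfl⟩
    simp only [mem_filter, mem_Iic]
    refine ⟨le_trans (by simp) hM.1, ?_⟩
    have := hM.1 j
    simp at this
    omega
  · intro N hN
    simp only [mem_filter, mem_Iic] at hN
    rw [wt_add_single hN.1, add_tsub_cancel_right]
    ring

/-- Multiplication by the sum of the variables is injective in the lower half of a box. -/
lemma box_injective {r : ℕ} (m : Fin r → ℕ) (i : ℕ) (hi : 2 * i < monDeg m)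
    (f0 : (Fin r → ℕ) → ℚ)
    (h : ∀ M, M ≤ m → monDeg M = i + 1 → opU f0 M = 0) (N : Fin r → ℕ) (hN : N ≤ m)
    (hNi : monDeg N = i) : f0 N = 0 := by
  classical
  set f : (Fin r → ℕ) → ℚ := fun M => if M ≤ m ∧ monDeg M = i then f0 M else 0 with hf
  have hU : ∀ M, M ≤ m → opU f M = 0 := by
    intro M hM
    by_cases hd : monDeg M = i + 1
    · rw [← h M hM hd]
      refine sum_congr rfl fun j _ => ?_
      split_ifs with h0
      · rfl
      · obtain ⟨L, rfl⟩ := exists_eq_add_single M j h0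
        rw [add_tsub_cancel_right, hf]
        rw [monDeg_add_single] at hd
        refine if_pos ⟨le_trans (by simp) hM, by omega⟩
    · refine sum_eq_zero fun j _ => ?_
      split_ifs with h0
      · rfl
      · obtain ⟨L, rfl⟩ := exists_eq_add_single M j h0
        rw [add_tsub_cancel_right, hf]
        rw [monDeg_add_single] at hd
        refine if_neg fun hc => by omega
  have h1 : ∑ M ∈ Iic m, wt m M * f M * opD m (opU f) M = 0 := by
    rw [← op_adj]
    refine sum_eq_zero fun M hM => ?_
    rw [hU M (mem_Iic.1 hM), mul_zero]
  have h2 : ∑ M ∈ Iic m, wt m M * f M * opD m (opU f) M =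
      ∑ M ∈ Iic m, wt m M * opD m f M * opD m f M +
      ((monDeg m : ℚ) - 2 * i) * ∑ M ∈ Iic m, wt m M * f M * f M := by
    rw [← op_adj m f (opD m f), mul_sum, ← sum_add_distrib]
    refine sum_congr rfl fun M _ => ?_
    rw [op_comm]
    by_cases hc : M ≤ m ∧ monDeg M = i
    · have : (∑ j, ((m j : ℚ) - 2 * M j)) = (monDeg m : ℚ) - 2 * i := by
        rw [sum_sub_distrib, ← mul_sum, ← hc.2]
        simp [monDeg]
      rw [this]
      ring
    · have : f M = 0 := if_neg hc
      rw [this]; ring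
  have h3 : 0 ≤ ∑ M ∈ Iic m, wt m M * opD m f M * opD m f M := by
    refine sum_nonneg fun M hM => ?_
    have := (wt_pos (mem_Iic.1 hM)).le
    rw [mul_assoc]
    exact mul_nonneg this (mul_self_nonneg _)
  have h4 : ∀ M ∈ Iic m, 0 ≤ wt m M * f M * f M := by
    intro M hM
    have := (wt_pos (mem_Iic.1 hM)).le
    rw [mul_assoc]
    exact mul_nonneg this (mul_self_nonneg _)
  have h5 : (0 : ℚ) < (monDeg m : ℚ) - 2 * i := by
    have : ((2 * i : ℕ) : ℚ) < monDeg m := by exact_mod_cast hi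
    push_cast at this
    linarith
  have h6 : ∑ M ∈ Iic m, wt m M * f M * f M = 0 := by
    have h7 := sum_nonneg h4
    rw [h1] at h2
    nlinarith
  have h8 := (sum_eq_zero_iff_of_nonneg h4).1 h6 N (mem_Iic.2 hN)
  have h9 := wt_pos hN
  have h10 : f N = f0 N := if_pos ⟨hN, hNi⟩
  rw [← h10]
  rcases mul_eq_zero.1 h8 with h | h
  · rcases mul_eq_zero.1 h with h | h
    · exact absurd h h9.ne'
    · exact h
  · exact h

end Part5

section Part6

/-! ### Leading monomials of the inverse system -/

open Finset

lemma card_lead {ι L : Type*} [Fintype ι] [LinearOrder L] (κ : ι → L)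
    (hκ : Function.Injective κ) (W : Submodule ℚ (ι → ℚ)) (S : Finset ι)
    (hS : ∀ i, i ∈ S ↔ ∃ φ ∈ W, φ i ≠ 0 ∧ ∀ k, κ i < κ k → φ k = 0) :
    #S = Module.finrank ℚ W := by
  classical
  apply le_antisymm
  · choose! φ hφW hφ0 hφ using fun i => (hS i).1
    have hli : LinearIndependent ℚ (fun i : S => (⟨φ i, hφW i i.2⟩ : W)) := by
      rw [Fintype.linearIndependent_iff]
      intro a ha
      by_contra hne
      push Not at hne
      obtain ⟨i0, hi0⟩ := hne
      obtain ⟨i, hi, hmax⟩ := exists_max_image (univ.filter fun i : S => a i ≠ 0)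
        (fun i => κ i) ⟨i0, by simpa using hi0⟩
      have h1 := congrArg (fun x : W => (x : ι → ℚ) i) ha
      simp only [Submodule.coe_sum, Submodule.coe_smul, Finset.sum_apply, Pi.smul_apply,
        smul_eq_mul, Submodule.coe_zero, Pi.zero_apply] at h1
      rw [sum_eq_single i] at h1
      · rcases mul_eq_zero.1 h1 with h | h
        · simp [h] at hi
        · exact hφ0 i i.2 h
      · intro k _ hk
        by_cases hak : a k = 0
        · simp [hak]
        · have hle := hmax k (by simpa using hak)
          have hlt : κ k < κ i := lt_of_le_of_ne hle fun h => hk (Subtype.ext (hκ h))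
          rw [hφ k k.2 i hlt, mul_zero]
      · simp
    have := hli.fintype_card_le_finrank
    simpa using this
  · let R : W →ₗ[ℚ] (S → ℚ) := (LinearMap.funLeft ℚ ℚ (fun i : S => (i : ι))).comp W.subtype
    have hR : Function.Injective R := by
      rw [injective_iff_map_eq_zero]
      rintro ⟨φ, hφ⟩ h0
      by_contra hne
      have hne' : φ ≠ 0 := fun h => hne (by simp [h])
      obtain ⟨i0, hi0⟩ := Function.ne_iff.1 hne'
      obtain ⟨i, hi, hmax⟩ := exists_max_image (univ.filter fun i => φ i ≠ 0) κ
        ⟨i0, by simpa using hi0⟩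
      have hiS : i ∈ S := by
        rw [hS]
        refine ⟨φ, hφ, by simpa using hi, fun k hk => ?_⟩
        by_contra hc
        exact absurd (hmax k (by simpa using hc)) (not_le.2 hk)
      have := congrFun h0 ⟨i, hiS⟩
      simp only [mem_filter, mem_univ, true_and] at hi
      exact hi this
    have := LinearMap.finrank_le_finrank_of_injective hR
    simpa using this

/-- Degree `d` part. -/
def degPart {r : ℕ} (X : Finset (Fin r → ℕ)) (d : ℕ) : Finset (Fin r → ℕ) :=
  X.filter fun M => monDeg M = d

lemma mem_degPart {r : ℕ} {X : Finset (Fin r → ℕ)} {d : ℕ} {M : Fin r → ℕ} :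
    M ∈ degPart X d ↔ M ∈ X ∧ monDeg M = d := by simp [degPart]

/-- Elements of the inverse system killed by the sum of the variables. -/
def InK {r : ℕ} (X : Finset (Fin r → ℕ)) (d : ℕ) (φ : (Fin r → ℕ) → ℚ) : Prop :=
  (∀ M, M ∉ degPart X d → φ M = 0) ∧ ∀ N : Fin r → ℕ, ∑ j, φ (N + Pi.single j 1) = 0

open Classical in
/-- Leading monomials. -/
noncomputable def leadMon {r : ℕ} (X : Finset (Fin r → ℕ)) (d : ℕ) : Finset (Fin r → ℕ) :=
  (degPart X d).filter fun M => ∃ φ, InK X d φ ∧ φ M ≠ 0 ∧ ∀ L, toLex M < toLex L → φ L = 0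

lemma mem_leadMon {r : ℕ} {X : Finset (Fin r → ℕ)} {d : ℕ} {M : Fin r → ℕ} :
    M ∈ leadMon X d ↔ M ∈ degPart X d ∧
      ∃ φ, InK X d φ ∧ φ M ≠ 0 ∧ ∀ L, toLex M < toLex L → φ L = 0 := by simp [leadMon]

lemma le_add_single {r : ℕ} (N : Fin r → ℕ) (j : Fin r) : N ≤ N + Pi.single j 1 := by simp

lemma leadMon_step {r : ℕ} {X : Finset (Fin r → ℕ)} (hX : IsOrderIdeal X) {d : ℕ}
    (N : Fin r → ℕ) (j : Fin r) (h : N + Pi.single j 1 ∈ leadMon X (d + 1)) :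
    N ∈ leadMon X d := by
  have hdown : ∀ L, L + Pi.single j 1 ∈ degPart X (d + 1) → L ∈ degPart X d := by
    intro L hL
    rw [mem_degPart, monDeg_add_single] at hL
    rw [mem_degPart]
    exact ⟨hX.2 _ hL.1 L (le_add_single L j), by omega⟩
  rw [mem_leadMon] at h ⊢
  obtain ⟨hm, φ, ⟨h1, h2⟩, h3, h4⟩ := h
  refine ⟨hdown N hm, fun L => φ (L + Pi.single j 1), ⟨?_, ?_⟩, h3, ?_⟩
  · intro M hM
    exact h1 _ fun hc => hM (hdown M hc)
  · intro L
    have := h2 (L + Pi.single j 1)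
    rw [← this]
    exact sum_congr rfl fun k _ => by rw [add_right_comm]
  · intro L hL
    apply h4
    rw [toLex_add, toLex_add]
    exact add_lt_add_left hL _

/-- Contraction by the sum of the variables. -/
noncomputable def contr {r : ℕ} (X : Finset (Fin r → ℕ)) (d : ℕ) :
    (degPart X (d + 1) → ℚ) →ₗ[ℚ] (degPart X d → ℚ) where
  toFun φ N := ∑ j, if h : (N : Fin r → ℕ) + Pi.single j 1 ∈ degPart X (d + 1) then φ ⟨_, h⟩ else 0
  map_add' φ ψ := by
    ext N
    simp only [Pi.add_apply, ← sum_add_distrib]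
    refine sum_congr rfl fun j _ => ?_
    split_ifs <;> simp
  map_smul' a φ := by
    ext N
    simp only [Pi.smul_apply, smul_eq_mul, mul_sum, RingHom.id_apply]
    refine sum_congr rfl fun j _ => ?_
    split_ifs <;> simp

lemma contr_apply {r : ℕ} (X : Finset (Fin r → ℕ)) (d : ℕ) (φ : degPart X (d + 1) → ℚ)
    (N : degPart X d) : contr X d φ N =
    ∑ j, if h : (N : Fin r → ℕ) + Pi.single j 1 ∈ degPart X (d + 1) then φ ⟨_, h⟩ else 0 := rfl

/-- In a pure order ideal every monomial divides one of socle degree. -/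
lemma exists_socle {r e : ℕ} {X : Finset (Fin r → ℕ)} (hX : IsPureWithSocle X e)
    (N : Fin r → ℕ) (hN : N ∈ X) : ∃ m ∈ X, N ≤ m ∧ monDeg m = e := by
  classical
  obtain ⟨m, hm, hmax⟩ := exists_max_image (X.filter fun M => N ≤ M) monDeg
    ⟨N, by simp [hN]⟩
  rw [mem_filter] at hm
  refine ⟨m, hm.1, hm.2, hX.2.2.2 m ⟨hm.1, fun M hM hle => ?_⟩⟩
  have h1 := hmax M (mem_filter.2 ⟨hM, le_trans hm.2 hle⟩)
  by_contra hne
  have : ∃ j, m j ≠ M j := by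
    by_contra hc
    push Not at hc
    exact hne (funext fun j => (hc j).symm)
  obtain ⟨j, hj⟩ := this
  have : monDeg m < monDeg M :=
    sum_lt_sum (fun i _ => hle i) ⟨j, mem_univ j, lt_of_le_of_ne (hle j) hj⟩
  omega

lemma contr_surj {r e : ℕ} {X : Finset (Fin r → ℕ)} (hX : IsPureWithSocle X e) {d : ℕ}
    (hd : 2 * d < e) : LinearMap.range (contr X d) = ⊤ := by
  classical
  by_contra hne
  obtain ⟨f, hf0, hf⟩ := Submodule.exists_le_ker_of_lt_top _ (lt_top_iff_ne_top.2 hne)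
  apply hf0
  let δ : (Fin r → ℕ) → (degPart X d → ℚ) := fun N L => if (L : Fin r → ℕ) = N then 1 else 0
  have key : ∀ M ∈ degPart X (d + 1), opU (fun N => f (δ N)) M = 0 := by
    intro M hM
    have h1 : f (contr X d (Pi.single ⟨M, hM⟩ 1)) = 0 := hf ⟨_, rfl⟩
    rw [← h1]
    have h2 : contr X d (Pi.single ⟨M, hM⟩ 1)
        = ∑ j, if M j = 0 then 0 else δ (M - Pi.single j 1) := by
      ext L
      rw [contr_apply, Finset.sum_apply]
      refine sum_congr rfl fun j _ => ?_
      by_cases hM0 : M j = 0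
      · have : ¬ (L : Fin r → ℕ) + Pi.single j 1 = M := by
          intro h
          have := congrFun h j
          simp [hM0] at this
        simp [hM0, Pi.single_apply, this]
      · obtain ⟨N, rfl⟩ := exists_eq_add_single M j hM0
        rw [if_neg hM0, add_tsub_cancel_right]
        by_cases hL : (L : Fin r → ℕ) = N
        · have : (L : Fin r → ℕ) + Pi.single j 1 ∈ degPart X (d + 1) := by rw [hL]; exact hM
          rw [dif_pos this]
          simp [δ, hL]
        · simp [δ, hL, Pi.single_apply]
    rw [h2, map_sum]
    refine sum_congr rfl fun j _ => ?_
    split_ifs <;> simp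
  refine LinearMap.pi_ext' fun N => LinearMap.ext_ring ?_
  obtain ⟨m, hm, hle, hme⟩ := exists_socle hX N (mem_degPart.1 N.2).1
  have h3 := box_injective m d (by omega) (fun N => f (δ N)) (fun M hM hMd => key M
    (mem_degPart.2 ⟨hX.1.2 m hm M hM, hMd⟩)) N hle (mem_degPart.1 N.2).2
  have h4 : δ N = Pi.single N 1 := by
    ext L
    simp only [δ, Pi.single_apply]
    exact if_congr Subtype.ext_iff.symm rfl rfl
  simp only [h4] at h3
  simpa using h3

lemma card_leadMon {r e : ℕ} {X : Finset (Fin r → ℕ)} (hX : IsPureWithSocle X e) {d : ℕ}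
    (hd : 2 * d < e) : #(leadMon X (d + 1)) + #(degPart X d) = #(degPart X (d + 1)) := by
  classical
  have h1 := LinearMap.finrank_range_add_finrank_ker (contr X d)
  rw [contr_surj hX hd, finrank_top, Module.finrank_fintype_fun_eq_card,
    Module.finrank_fintype_fun_eq_card, Fintype.card_coe, Fintype.card_coe] at h1
  have h2 := card_lead (fun M : degPart X (d + 1) => toLex (M : Fin r → ℕ))
    (fun a b h => Subtype.ext (toLex.injective h)) (LinearMap.ker (contr X d))
    ((leadMon X (d + 1)).subtype (· ∈ degPart X (d + 1))) ?_
  · rw [card_subtype, filter_true_of_mem fun M hM => (mem_leadMon.1 hM).1] at h2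
    omega
  · intro M
    rw [mem_subtype, mem_leadMon]
    constructor
    · rintro ⟨_, φ, ⟨hs, hk⟩, h0, hl⟩
      refine ⟨fun L => φ L, ?_, h0, fun L hL => hl L hL⟩
      rw [LinearMap.mem_ker]
      ext N
      rw [contr_apply, Pi.zero_apply]
      refine Eq.trans ?_ (hk N)
      refine sum_congr rfl fun j _ => ?_
      split_ifs with h
      · rfl
      · exact (hs _ h).symm
    · rintro ⟨φ, hk, h0, hl⟩
      refine ⟨M.2, fun L => if h : L ∈ degPart X (d + 1) then φ ⟨L, h⟩ else 0, ⟨?_, ?_⟩, ?_, ?_⟩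
      · intro L hL
        exact dif_neg hL
      · intro N
        by_cases hN : N ∈ degPart X d
        · have := congrFun (LinearMap.mem_ker.1 hk) ⟨N, hN⟩
          rw [contr_apply] at this
          exact this
        · refine sum_eq_zero fun j _ => dif_neg fun h => hN ?_
          rw [mem_degPart, monDeg_add_single] at h
          rw [mem_degPart]
          exact ⟨hX.1.2 _ h.1 N (le_add_single N j), by omega⟩
      · simpa using h0
      · intro L hL
        dsimp only
        split_ifs with h
        · exact hl ⟨L, h⟩ hL
        · rfl

lemma differentiable_of_pure (h : ℕ → ℕ) (e : ℕ) (h0 : h 0 = 1) (e' : ℕ) (g : ℕ → ℕ)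
    (he : e ≤ e' / 2) (hg : IsPureOSeq g e') (hgh : ∀ i ≤ e, g i = h i) :
    IsDifferentiable h e := by
  obtain ⟨r, X, hX, hv⟩ := hg
  have hh : ∀ i ≤ e, h i = #(degPart X i) := fun i hi => by
    rw [← hgh i hi, hv i (by omega)]; rfl
  have hc : ∀ i, i + 1 ≤ e → #(leadMon X (i + 1)) + h i = h (i + 1) := by
    intro i hi
    rw [hh i (by omega), hh (i + 1) hi]
    exact card_leadMon hX (by omega)
  refine ⟨h0, ?_, ?_⟩
  · intro i h1 h2
    obtain ⟨k, rfl⟩ : ∃ k, i = k + 1 := ⟨i - 1, by omega⟩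
    have := hc k h2
    simp only [Nat.add_sub_cancel]
    omega
  · intro i h1 h2
    obtain ⟨k, rfl⟩ : ∃ k, i = k + 1 := ⟨i - 1, by omega⟩
    have e1 := hc k (by omega)
    have e2 := hc (k + 1) h2
    simp only [Nat.add_sub_cancel, Nat.add_eq_zero_iff, one_ne_zero, and_false, if_false]
    have e3 : h (k + 1 + 1) - h (k + 1) = #(leadMon X (k + 1 + 1)) := by omega
    have e4 : h (k + 1) - h k = #(leadMon X (k + 1)) := by omega
    rw [e3, e4]
    refine macaulay_monomials h1 _ _ ?_ ?_ ?_
    · intro M hM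
      exact (mem_degPart.1 (mem_leadMon.1 hM).1).2
    · intro M hM
      exact (mem_degPart.1 (mem_leadMon.1 hM).1).2
    · intro N j hN
      exact leadMon_step hX.1 N j hN

end Part6

/-- A sequence `(h 0 = 1, h 1, …, h e)` of positive integers is
differentiable if and only if it is the "first half" of a pure O-sequence: precisely,
iff there is a pure O-sequence `g` of socle degree `e'` with `⌊e'/2⌋ ≥ e` agreeing with
`h` in degrees `≤ e`; and in that case one may take `e' = 2e`. -/
theorem differentiable_iff_first_half_of_pure (h : ℕ → ℕ) (e : ℕ)
    (h0 : h 0 = 1) (hpos : ∀ i ≤ e, 0 < h i) :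
    (IsDifferentiable h e ↔
      ∃ (e' : ℕ) (g : ℕ → ℕ), e ≤ e' / 2 ∧ IsPureOSeq g e' ∧ ∀ i ≤ e, g i = h i) ∧
    (IsDifferentiable h e →
      ∃ g : ℕ → ℕ, IsPureOSeq g (2 * e) ∧ ∀ i ≤ e, g i = h i) := by
  refine ⟨⟨fun hd => ?_, fun ⟨e', g, he, hg, hgh⟩ => differentiable_of_pure h e h0 e' g he hg hgh⟩,
    exists_pure h e⟩
  obtain ⟨g, hg, hgh⟩ := exists_pure h e hd
  exact ⟨2 * e, g, by omega, hg, hgh⟩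
end

section
/- Every non-decreasing pure O-sequence (h_0, h_1, …, h_e) of socle degree e ≤ 3 (i.e., with h_0 ≤ h_1 ≤ ⋯ ≤ h_e) is differentiable. -/
lemma mb_two (k j : ℕ) (hj : j < k) :
    macaulayBound (k.choose 2 + j) 2 = (k + 1).choose 3 + (j + 1).choose 2 := by
  rcases hn : k.choose 2 + j with _ | n
  · have hj0 : j = 0 := by omega
    have hk : k < 2 := by
      by_contra hk
      have := Nat.choose_pos (n := k) (k := 2) (by omega)
      omega
    have : k = 1 := by omega
    subst this; subst hj0
    rw [mb_zero]; rfl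
  · have hs : (k + 1).choose 2 = k + k.choose 2 := by
      rw [Nat.choose_succ_succ' k 1]; simp
    have h : Nat.findGreatest (fun k => Nat.choose k 2 ≤ n + 1) (n + 1 + 2) = k := by
      rw [Nat.findGreatest_eq_iff]
      refine ⟨?_, fun _ => by omega, ?_⟩
      · by_contra hk
        have h1 : (n + 3 + 1).choose 2 ≤ k.choose 2 := Nat.choose_le_choose 2 (by omega)
        rw [Nat.choose_succ_succ' (n + 3) 1] at h1
        simp at h1
        omega
      · intro q hq _ h
        have h1 : (k + 1).choose 2 ≤ q.choose 2 := Nat.choose_le_choose 2 (by omega)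
        omega
    rw [macaulayBound, h]
    have : n + 1 - k.choose 2 = j := by omega
    rw [this]
    simp [mb_one]

lemma tri2 (k : ℕ) : 2 * (k + 1).choose 2 = k * (k + 1) := by
  induction k with
  | zero => rfl
  | succ k ih =>
    rw [Nat.choose_succ_succ' (k + 1) 1, mul_add, ih]; simp; ring

lemma exists_rep (n : ℕ) : ∃ k j, j < k ∧ n = k.choose 2 + j := by
  induction n with
  | zero => exact ⟨1, 0, by omega, rfl⟩
  | succ n ih =>
    obtain ⟨k, j, hj, rfl⟩ := ih
    by_cases h : j + 1 < k
    · exact ⟨k, j + 1, h, by omega⟩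
    · refine ⟨k + 1, 0, by omega, ?_⟩
      rw [Nat.choose_succ_succ' k 1]; simp; omega

lemma mb_gap (n r : ℕ) (h : r * (r + 1) ≤ 2 * n) :
    macaulayBound (n - r) 2 + (r + 1).choose 2 ≤ macaulayBound n 2 := by
  obtain ⟨k, j, hj, rfl⟩ := exists_rep n
  obtain ⟨k, rfl⟩ : ∃ q, k = q + 1 := ⟨k - 1, by omega⟩
  have hk := tri2 k
  have hr := tri2 r
  have hrk : r ≤ k := by
    by_contra hc
    have h1 : (k + 1) * (k + 2) ≤ r * (r + 1) := Nat.mul_le_mul (by omega) (by omega)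
    nlinarith
  rw [mb_two _ _ hj]
  by_cases hrj : r ≤ j
  · obtain ⟨i, rfl⟩ := Nat.exists_eq_add_of_le hrj
    have e : (k + 1).choose 2 + (r + i) - r = (k + 1).choose 2 + i := by omega
    rw [e, mb_two _ _ (by omega)]
    have h1 := tri2 i
    have h2 := tri2 (r + i)
    nlinarith
  · obtain ⟨i, rfl⟩ := Nat.exists_eq_add_of_le (show j ≤ r by omega)
    obtain ⟨p, rfl⟩ := Nat.exists_eq_add_of_le hrk
    have hs : (j + i + p + 1).choose 2 = (j + i + p) + (j + i + p).choose 2 := by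
      rw [Nat.choose_succ_succ' _ 1]; simp
    have e : (j + i + p + 1).choose 2 + j - (j + i) = (j + i + p).choose 2 + (j + p) := by omega
    rw [e, mb_two _ _ (by omega)]
    have h1 := tri2 (j + p)
    have h2 := tri2 j
    have h3 : (j + i + p + 1 + 1).choose 3
      = (j + i + p + 1).choose 2 + (j + i + p + 1).choose 3 := Nat.choose_succ_succ' _ 2
    nlinarith

/-! ### Clique counting -/

section Cliques
open Finset

variable {α : Type} [DecidableEq α]

/-- The `k`-cliques inside `S`, for the graph with neighbourhoods `N`. -/
def cls (N : α → Finset α) (k : ℕ) (S : Finset α) : Finset (Finset α) :=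
  {e ∈ powersetCard k S | ∀ x ∈ e, ∀ y ∈ e, x ≠ y → y ∈ N x}

lemma mem_cls (N : α → Finset α) (k : ℕ) (S e : Finset α) :
    e ∈ cls N k S ↔ e ∈ powersetCard k S ∧ ∀ x ∈ e, ∀ y ∈ e, x ≠ y → y ∈ N x := by
  simp only [cls, mem_filter]

/-- Number of `k`-cliques inside `S`. -/
def cl (N : α → Finset α) (k : ℕ) (S : Finset α) : ℕ := #(cls N k S)

lemma cl_insert (N : α → Finset α) (sym : ∀ x y, y ∈ N x → x ∈ N y) (k : ℕ) (S : Finset α)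
    (v : α) (hv : v ∉ S) : cl N (k + 1) (insert v S) = cl N (k + 1) S + cl N k (S ∩ N v) := by
  unfold cl cls
  rw [powersetCard_succ_insert hv, filter_union, card_union_of_disjoint]
  · congr 1
    symm
    apply card_bij (fun e _ => insert v e)
    · intro e he
      simp only [mem_filter, mem_powersetCard, mem_image] at he ⊢
      obtain ⟨⟨h1, h2⟩, h3⟩ := he
      refine ⟨⟨e, ⟨fun x hx => (mem_inter.1 (h1 hx)).1, h2⟩, rfl⟩, ?_⟩
      intro x hx y hy hxy
      rcases mem_insert.1 hx with hx1 | hx1 <;> rcases mem_insert.1 hy with hy1 | hy1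
      · exact absurd (hx1.trans hy1.symm) hxy
      · rw [hx1]; exact (mem_inter.1 (h1 hy1)).2
      · rw [hy1]; exact sym _ _ (mem_inter.1 (h1 hx1)).2
      · exact h3 x hx1 y hy1 hxy
    · intro e he e' he' h
      simp only [mem_filter, mem_powersetCard] at he he'
      have h1 : v ∉ e := fun hh => hv (mem_inter.1 (he.1.1 hh)).1
      have h2 : v ∉ e' := fun hh => hv (mem_inter.1 (he'.1.1 hh)).1
      rw [← erase_insert h1, ← erase_insert h2, h]
    · intro e he
      simp only [mem_filter, mem_powersetCard, mem_image] at he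
      obtain ⟨⟨e', ⟨h1, h2⟩, rfl⟩, h3⟩ := he
      refine ⟨e', ?_, rfl⟩
      simp only [mem_filter, mem_powersetCard]
      refine ⟨⟨?_, h2⟩, fun x hx y hy => h3 x (mem_insert_of_mem hx) y (mem_insert_of_mem hy)⟩
      intro x hx
      refine mem_inter.2 ⟨h1 hx, h3 v (mem_insert_self _ _) x (mem_insert_of_mem hx) ?_⟩
      rintro rfl
      exact hv (h1 hx)
  · rw [disjoint_left]
    intro e he he'
    simp only [mem_filter, mem_powersetCard, mem_image] at he he'
    obtain ⟨⟨e', _, rfl⟩, _⟩ := he'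
    exact hv (he.1.1 (mem_insert_self _ _))

lemma cl_one (N : α → Finset α) (S : Finset α) : cl N 1 S = #S := by
  unfold cl cls
  rw [filter_true_of_mem, card_powersetCard, Nat.choose_one_right]
  intro e he x hx y hy hxy
  obtain ⟨z, rfl⟩ := card_eq_one.1 (mem_powersetCard.1 he).2
  simp at hx hy
  exact absurd (hx.trans hy.symm) hxy

lemma cl_le (N : α → Finset α) (k : ℕ) (S : Finset α) : cl N k S ≤ (#S).choose k := by
  unfold cl cls
  exact (card_filter_le _ _).trans (card_powersetCard _ _).le

lemma card_insert_inter (v : α) (S T : Finset α) (hv : v ∉ S) :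
    #(insert v S ∩ T) = #(S ∩ T) + if v ∈ T then 1 else 0 := by
  by_cases h : v ∈ T
  · rw [insert_inter_of_mem h, card_insert_of_notMem (by simp [hv])]; simp [h]
  · rw [insert_inter_of_notMem h]; simp [h]

lemma handshake (N : α → Finset α) (sym : ∀ x y, y ∈ N x → x ∈ N y) (irr : ∀ x, x ∉ N x)
    (S : Finset α) : ∑ x ∈ S, #(S ∩ N x) = 2 * cl N 2 S := by
  induction S using Finset.induction_on with
  | empty => simp [cl, cls]
  | insert v S hv ih =>
    rw [sum_insert hv, cl_insert N sym 1 S v hv, cl_one, mul_add, ← ih, card_insert_inter _ _ _ hv]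
    simp only [card_insert_inter v S _ hv, sum_add_distrib, irr v, if_false]
    have : ∑ x ∈ S, (if v ∈ N x then 1 else 0) = #(S ∩ N v) := by
      rw [← card_filter]
      congr 1
      ext x
      simp only [mem_filter, mem_inter]
      exact ⟨fun h => ⟨h.1, sym _ _ h.2⟩, fun h => ⟨h.1, sym _ _ h.2⟩⟩
    rw [this]; ring

lemma cl_two_split (N : α → Finset α) (sym : ∀ x y, y ∈ N x → x ∈ N y)
    (Q P : Finset α) : ∀ T : Finset α, T ⊆ Q → Q ⊆ P →
      cl N 2 Q ≤ cl N 2 (Q \ T) + ∑ x ∈ T, #(P ∩ N x) := by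
  intro T
  induction T using Finset.induction_on with
  | empty => simp
  | insert v T hv ih =>
    intro hT hP
    have h1 := ih ((subset_insert _ _).trans hT) hP
    have h2 : Q \ T = insert v (Q \ insert v T) := by
      ext x
      have := hT (mem_insert_self v T)
      by_cases hx : x = v
      · subst hx; simp [this, hv]
      · simp [hx]
    rw [h2, cl_insert N sym 1 _ v (by simp), cl_one, one_add_one_eq_two] at h1
    rw [sum_insert hv]
    have h3 : #((Q \ insert v T) ∩ N v) ≤ #(P ∩ N v) :=
      card_le_card (inter_subset_inter (sdiff_subset.trans hP) (subset_refl _))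
    omega

/-- Number of monomials `x^2 y` with `x` looped. -/
def dsum (N : α → Finset α) (S L : Finset α) : ℕ :=
  ∑ x ∈ S, if x ∈ L then #(S ∩ N x) else 0

lemma dsum_insert (N : α → Finset α) (sym : ∀ x y, y ∈ N x → x ∈ N y) (irr : ∀ x, x ∉ N x)
    (S L : Finset α) (v : α) (hv : v ∉ S) :
    dsum N (insert v S) L = (if v ∈ L then #(S ∩ N v) else 0) + dsum N S L +
      #((S ∩ N v) ∩ L) := by
  unfold dsum
  rw [sum_insert hv, card_insert_inter _ _ _ hv]
  simp only [irr v, if_false, add_zero]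
  rw [add_assoc]
  congr 1
  have : #((S ∩ N v) ∩ L) = ∑ x ∈ S, if x ∈ L ∧ v ∈ N x then 1 else 0 := by
    rw [← card_filter]
    congr 1
    ext x
    simp only [mem_filter, mem_inter]
    exact ⟨fun h => ⟨h.1.1, h.2, sym _ _ h.1.2⟩, fun h => ⟨⟨h.1, sym _ _ h.2.2⟩, h.2.1⟩⟩
  rw [this, ← sum_add_distrib]
  apply sum_congr rfl
  intro x _
  by_cases hx : x ∈ L <;> simp [hx, card_insert_inter _ _ _ hv]

lemma dsum_union (N : α → Finset α) (S L T : Finset α) (hT : T ⊆ S) (hd : Disjoint L T) :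
    dsum N S (L ∪ T) = dsum N S L + ∑ x ∈ T, #(S ∩ N x) := by
  unfold dsum
  have : ∑ x ∈ T, #(S ∩ N x) = ∑ x ∈ S, if x ∈ T then #(S ∩ N x) else 0 := by
    rw [← sum_filter]
    congr 1
    ext x
    simp only [mem_filter]
    exact ⟨fun h => ⟨hT h, h⟩, fun h => h.2⟩
  rw [this, ← sum_add_distrib]
  apply sum_congr rfl
  intro x _
  by_cases h1 : x ∈ L
  · have h2 : x ∉ T := disjoint_left.1 hd h1
    simp [h1, h2]
  · simp [h1]

theorem main_graph (N : α → Finset α) (sym : ∀ x y, y ∈ N x → x ∈ N y) (irr : ∀ x, x ∉ N x)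
    (φ : α → α) : ∀ (k : ℕ) (S L : Finset α), #S = k →
    (∀ x ∈ S \ L, φ x ∈ S ∩ N x) → (∀ x ∈ S \ L, φ x ∉ L → φ (φ x) ≠ x) →
    #(S \ L) ≤ cl N 2 S ∧
      dsum N S L + cl N 3 S ≤ cl N 2 S + macaulayBound (cl N 2 S - #(S \ L)) 2 := by
  intro k
  induction k with
  | zero =>
    intro S L hS _ _
    rw [card_eq_zero] at hS
    subst hS
    have h2 : cl N 2 (∅ : Finset α) ≤ 0 := cl_le N 2 ∅
    have h3 : cl N 3 (∅ : Finset α) ≤ 0 := cl_le N 3 ∅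
    have hd : dsum N ∅ L = 0 := by simp [dsum]
    have hc : #((∅ : Finset α) \ L) = 0 := by simp
    omega
  | succ k ih =>
    intro S L hS h1 h2
    -- the fibres of `φ`
    set T : α → Finset α := fun v => {x ∈ S \ L | φ x = v} with hT
    have hTsub : ∀ v, T v ⊆ S ∩ N v := by
      intro v x hx
      simp only [hT, mem_filter] at hx
      have h3 := h1 x hx.1
      rw [hx.2] at h3
      exact mem_inter.2 ⟨(mem_sdiff.1 hx.1).1, sym _ _ (mem_inter.1 h3).2⟩
    have hTL : ∀ v, Disjoint L (T v) := by
      intro v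
      rw [disjoint_right]
      intro x hx
      simp only [hT, mem_filter, mem_sdiff] at hx
      exact hx.1.2
    have hdeg : ∀ v ∈ S, #(T v) + (if v ∈ L then 0 else 1) ≤ #(S ∩ N v) := by
      intro v hv
      by_cases hvL : v ∈ L
      · simpa [hvL] using card_le_card (hTsub v)
      · have hvS : v ∈ S \ L := mem_sdiff.2 ⟨hv, hvL⟩
        have h3 : φ v ∉ T v := by
          intro hc
          simp only [hT, mem_filter] at hc
          exact h2 v hvS (mem_sdiff.1 hc.1).2 hc.2
        have h4 : insert (φ v) (T v) ⊆ S ∩ N v := insert_subset (h1 v hvS) (hTsub v)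
        have h5 := card_le_card h4
        rw [card_insert_of_notMem h3] at h5
        simpa [hvL] using h5
    have hsumT : ∑ v ∈ S, #(T v) = #(S \ L) := by
      symm
      apply card_eq_sum_card_fiberwise
      intro x hx
      exact (mem_inter.1 (h1 x hx)).1
    have hsumU : ∑ v ∈ S, (if v ∈ L then 0 else 1) = #(S \ L) := by
      rw [sdiff_eq_filter, card_filter]
      apply sum_congr rfl
      intro x _
      by_cases hx : x ∈ L <;> simp [hx]
    have hsumD := handshake N sym irr S
    have hum : #(S \ L) ≤ cl N 2 S := by
      have := sum_le_sum hdeg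
      rw [sum_add_distrib] at this
      omega
    refine ⟨hum, ?_⟩
    -- reduced degrees
    set ρ : α → ℕ := fun v => #(S ∩ N v) - (#(T v) + (if v ∈ L then 0 else 1)) with hρ
    have hρeq : ∀ v ∈ S, ρ v + (#(T v) + (if v ∈ L then 0 else 1)) = #(S ∩ N v) := by
      intro v hv
      exact Nat.sub_add_cancel (hdeg v hv)
    have hsumρ : ∑ v ∈ S, ρ v = 2 * (cl N 2 S - #(S \ L)) := by
      have := sum_congr rfl hρeq
      rw [sum_add_distrib, sum_add_distrib] at this
      omega
    obtain ⟨v, hv, hmin⟩ := exists_min_image S ρ (card_pos.1 (by omega))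
    have hle : #S * ρ v ≤ 2 * (cl N 2 S - #(S \ L)) := by
      rw [← hsumρ, ← smul_eq_mul]
      exact card_nsmul_le_sum _ _ _ hmin
    obtain ⟨S', hvS', rfl⟩ : ∃ S', v ∉ S' ∧ S = insert v S' :=
      ⟨S.erase v, notMem_erase _ _, (insert_erase hv).symm⟩
    have hSN : insert v S' ∩ N v = S' ∩ N v := insert_inter_of_notMem (irr v)
    rw [card_insert_of_notMem hvS'] at hS hle
    have hρv := hρeq v hv
    have hTv := hTsub v
    rw [hSN] at hρv hTv
    have hdS : #(S' ∩ N v) ≤ #S' := card_le_card inter_subset_left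
    have hgap := mb_gap (cl N 2 (insert v S') - #(insert v S' \ L)) (ρ v) (by
      refine le_trans ?_ hle
      rw [mul_comm]
      exact Nat.mul_le_mul (by omega) le_rfl)
    -- the induction hypothesis
    have hIH := ih S' (L ∪ T v) (by omega) (by
        intro x hx
        simp only [mem_sdiff, mem_union, not_or] at hx
        have hx1 : x ∈ insert v S' \ L := mem_sdiff.2 ⟨mem_insert_of_mem hx.1, hx.2.1⟩
        have h3 := mem_inter.1 (h1 x hx1)
        refine mem_inter.2 ⟨?_, h3.2⟩
        rcases mem_insert.1 h3.1 with h4 | h4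
        · exact absurd (mem_filter.2 ⟨hx1, h4⟩) hx.2.2
        · exact h4) (by
        intro x hx hxL
        simp only [mem_sdiff, mem_union, not_or] at hx hxL
        exact h2 x (mem_sdiff.2 ⟨mem_insert_of_mem hx.1, hx.2.1⟩) hxL.1)
    obtain ⟨hI1, hI2⟩ := hIH
    have hu : #(insert v S' \ L) = #(S' \ (L ∪ T v)) + #(T v) + (if v ∈ L then 0 else 1) := by
      have e1 : #(S' \ L) = #(S' \ (L ∪ T v)) + #(T v) := by
        rw [← card_sdiff_add_card_eq_card (s := T v) (t := S' \ L), sdiff_sdiff_left]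
        · rfl
        · intro x hx
          exact mem_sdiff.2 ⟨(mem_inter.1 (hTv hx)).1, disjoint_right.1 (hTL v) hx⟩
      by_cases hvL : v ∈ L
      · rw [insert_sdiff_of_mem _ hvL]; simp [hvL, e1]
      · rw [insert_sdiff_of_notMem _ hvL, card_insert_of_notMem (by simp [hvS'])]; simp [hvL, e1]
    have hm := cl_insert N sym 1 S' v hvS'
    rw [cl_one, one_add_one_eq_two] at hm
    have ht : cl N 3 (insert v S') = cl N 3 S' + cl N 2 (S' ∩ N v) :=
      cl_insert N sym 2 S' v hvS'
    have hD := dsum_insert N sym irr S' L v hvS'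
    have hD' := dsum_union N S' L (T v) (hTv.trans inter_subset_left) (hTL v)
    have hsp := cl_two_split N sym (S' ∩ N v) S' (T v) hTv inter_subset_left
    have hQ := cl_le N 2 ((S' ∩ N v) \ T v)
    have hQc := card_sdiff_add_card_eq_card hTv
    have hdL : #((S' ∩ N v) ∩ L) ≤ #((S' ∩ N v) \ T v) := by
      apply card_le_card
      intro x hx
      have := mem_inter.1 hx
      exact mem_sdiff.2 ⟨this.1, disjoint_left.1 (hTL v) this.2⟩
    have hn : cl N 2 (insert v S') - #(insert v S' \ L) - ρ v
        = cl N 2 S' - #(S' \ (L ∪ T v)) := by omega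
    rw [hn] at hgap
    have hfin : (if v ∈ L then #(S' ∩ N v) else 0) + #((S' ∩ N v) ∩ L) + cl N 2 ((S' ∩ N v) \ T v)
        ≤ #(S' ∩ N v) + (ρ v + 1).choose 2 := by
      by_cases hvL : v ∈ L
      · simp only [hvL, if_true] at hρv ⊢
        have e : #((S' ∩ N v) \ T v) = ρ v := by omega
        rw [e] at hQ hdL
        have : (ρ v + 1).choose 2 = ρ v + (ρ v).choose 2 := by
          rw [Nat.choose_succ_succ' _ 1]; simp
        omega
      · simp only [hvL, if_false] at hρv ⊢
        have e : #((S' ∩ N v) \ T v) = ρ v + 1 := by omega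
        rw [e] at hQ hdL
        omega
    omega

end Cliques

/-! ### The partner function -/

section Partner
open Finset

theorem exists_partner {α : Type} [DecidableEq α] (N : α → Finset α)
    (sym : ∀ x y, y ∈ N x → x ∈ N y) (irr : ∀ x, x ∉ N x) (V L : Finset α)
    (hNV : ∀ x, N x ⊆ V)
    (hyp : ∀ w ∈ V \ L, (∃ y ∈ N w, y ∈ L) ∨ 2 ≤ #(N w)) :
    ∃ φ : α → α, (∀ x ∈ V \ L, φ x ∈ V ∩ N x) ∧
      (∀ x ∈ V \ L, φ x ∉ L → φ (φ x) ≠ x) := by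
  classical
  set W : Finset α := {w ∈ V \ L | ¬ ∃ y ∈ N w, y ∈ L} with hW
  have hall : ∃ f : {w // w ∈ W} → Sym2 α, Function.Injective f ∧
      ∀ x : {w // w ∈ W}, f x ∈ (N x.1).image (fun y => s(x.1, y)) := by
    rw [← Finset.all_card_le_biUnion_card_iff_exists_injective]
    intro s
    have := Finset.card_mul_le_card_mul (s := s)
      (t := s.biUnion fun x => (N x.1).image (fun y => s(x.1, y)))
      (fun (x : {w // w ∈ W}) (e : Sym2 α) => x.1 ∈ e) (m := 2) (n := 2) ?_ ?_
    · omega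
    · intro x hx
      have hx2 := x.2
      replace hx2 := mem_filter.1 hx2
      have h2 : 2 ≤ #(N x.1) := (hyp x.1 hx2.1).resolve_left hx2.2
      have h3 : #((N x.1).image (fun y => s(x.1, y))) = #(N x.1) := by
        apply card_image_of_injective
        intro y z hyz
        exact Sym2.congr_right.1 hyz
      rw [← h3] at h2
      refine h2.trans (card_le_card ?_)
      intro e he
      rw [mem_bipartiteAbove]
      refine ⟨mem_biUnion.2 ⟨x, hx, he⟩, ?_⟩
      obtain ⟨y, _, rfl⟩ := mem_image.1 he
      simp
    · intro e he
      induction e using Sym2.ind with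
      | _ a b =>
        have h4 : #((bipartiteBelow (fun (x : {w // w ∈ W}) (e : Sym2 α) => x.1 ∈ e) s s(a, b)).image
            Subtype.val) ≤ #({a, b} : Finset α) := by
          apply card_le_card
          intro x hx
          obtain ⟨y, hy, rfl⟩ := mem_image.1 hx
          rw [mem_bipartiteBelow] at hy
          simpa using hy.2
        rw [card_image_of_injective _ Subtype.val_injective] at h4
        exact h4.trans card_le_two
  obtain ⟨f, finj, hf⟩ := hall
  have hch : ∀ x, ∃ y, x ∈ V \ L → (y ∈ N x ∧ (∀ h : x ∈ W, f ⟨x, h⟩ = s(x, y)) ∧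
      (x ∉ W → y ∈ L)) := by
    intro x
    by_cases hx : x ∈ V \ L
    · by_cases hxW : x ∈ W
      · obtain ⟨y, hy, hy2⟩ := mem_image.1 (hf ⟨x, hxW⟩)
        exact ⟨y, fun _ => ⟨hy, fun _ => hy2.symm, fun h => absurd hxW h⟩⟩
      · have : ∃ y ∈ N x, y ∈ L := by
          by_contra hc
          exact hxW (mem_filter.2 ⟨hx, hc⟩)
        obtain ⟨y, hy, hyL⟩ := this
        exact ⟨y, fun _ => ⟨hy, fun h => absurd h hxW, fun _ => hyL⟩⟩
    · exact ⟨x, fun h => absurd h hx⟩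
  choose φ hφ using hch
  refine ⟨φ, fun x hx => mem_inter.2 ⟨hNV x (hφ x hx).1, (hφ x hx).1⟩, ?_⟩
  intro x hx hxL hc
  obtain ⟨h1, h2, h3⟩ := hφ x hx
  have hxW : x ∈ W := by
    by_contra h
    exact hxL (h3 h)
  have hy : φ x ∈ V \ L := mem_sdiff.2 ⟨hNV x h1, hxL⟩
  obtain ⟨h4, h5, h6⟩ := hφ (φ x) hy
  have hyW : φ x ∈ W := by
    by_contra h
    have := h6 h
    rw [hc] at this
    exact (mem_sdiff.1 hx).2 this
  have e1 := h2 hxW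
  have e2 := h5 hyW
  rw [hc, Sym2.eq_swap] at e2
  have e3 := finj (e1.trans e2.symm)
  have e4 : x = φ x := congrArg Subtype.val e3
  rw [← e4] at h1
  exact irr x h1

end Partner

/-! ### From monomials to graphs -/

section Monomials
open Finset

variable {r : ℕ}

lemma exists_lt_of_deg (N M : Fin r → ℕ) (h : monDeg N < monDeg M) : ∃ y, N y < M y := by
  by_contra hc
  push Not at hc
  have : monDeg M ≤ monDeg N := sum_le_sum fun j _ => hc j
  omega

lemma eq_of_le_deg (N M : Fin r → ℕ) (hle : ∀ j, N j ≤ M j) (h : monDeg M ≤ monDeg N) :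
    N = M := by
  by_contra hne
  obtain ⟨j, hj⟩ := Function.ne_iff.1 hne
  have : monDeg N < monDeg M :=
    sum_lt_sum (fun j _ => hle j) ⟨j, mem_univ _, lt_of_le_of_ne (hle j) hj⟩
  omega

/-- The squarefree monomial with support `e`. -/
def chi (e : Finset (Fin r)) : Fin r → ℕ := fun x => if x ∈ e then 1 else 0

/-- The power `x ^ k`. -/
def pw (x : Fin r) (k : ℕ) : Fin r → ℕ := fun y => if y = x then k else 0

lemma monDeg_chi (e : Finset (Fin r)) : monDeg (chi e) = #e := by
  simp [monDeg, chi]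

lemma monDeg_pw (x : Fin r) (k : ℕ) : monDeg (pw x k) = k := by
  simp [monDeg, pw]

lemma chi_inj : Function.Injective (chi (r := r)) := by
  intro e f h
  ext x
  have := congrFun h x
  simp only [chi] at this
  by_cases h1 : x ∈ e <;> by_cases h2 : x ∈ f <;> simp_all

lemma pw_inj (k : ℕ) (hk : k ≠ 0) : Function.Injective (fun x : Fin r => pw x k) := by
  intro x y h
  have := congrFun h x
  simp only [pw] at this
  by_contra hne
  simp [hne, hk] at this

lemma pw_le (x : Fin r) (k : ℕ) (M : Fin r → ℕ) (h : k ≤ M x) : ∀ j, pw x k j ≤ M j := by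
  intro j
  unfold pw
  split_ifs with hj
  · rw [hj]; exact h
  · exact Nat.zero_le _

lemma chi_le (e : Finset (Fin r)) (M : Fin r → ℕ) (h : ∀ x ∈ e, 1 ≤ M x) :
    ∀ j, chi e j ≤ M j := by
  intro j
  unfold chi
  split_ifs with hj
  · exact h j hj
  · exact Nat.zero_le _

lemma eq_chi (M : Fin r → ℕ) (h : ∀ x, M x ≤ 1) : ∃ e, M = chi e := by
  refine ⟨univ.filter (fun x => M x = 1), ?_⟩
  ext x
  simp only [chi, mem_filter, mem_univ, true_and]
  have := h x
  split_ifs <;> omega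

variable (X : Finset (Fin r → ℕ))

/-- variables of `X` -/
def vars : Finset (Fin r) := {x | pw x 1 ∈ X}
/-- variables with square in `X` -/
def loops : Finset (Fin r) := {x | pw x 2 ∈ X}
/-- graph of squarefree quadratic monomials of `X` -/
def nbr (x : Fin r) : Finset (Fin r) := {y | y ≠ x ∧ chi {x, y} ∈ X}

lemma nbr_sym (x y : Fin r) (h : y ∈ nbr X x) : x ∈ nbr X y := by
  simp only [nbr, mem_filter, mem_univ, true_and] at h ⊢
  exact ⟨h.1.symm, by rw [pair_comm]; exact h.2⟩

lemma nbr_irr (x : Fin r) : x ∉ nbr X x := by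
  simp [nbr]

variable {X}

lemma mem_vars_of (hX : IsOrderIdeal X) {M : Fin r → ℕ} (hM : M ∈ X) {x : Fin r} (h : 1 ≤ M x) :
    x ∈ vars X := by
  simp only [vars, mem_filter, mem_univ, true_and]
  exact hX.2 M hM _ (pw_le x 1 M h)

lemma mem_loops_of (hX : IsOrderIdeal X) {M : Fin r → ℕ} (hM : M ∈ X) {x : Fin r} (h : 2 ≤ M x) :
    x ∈ loops X := by
  simp only [loops, mem_filter, mem_univ, true_and]
  exact hX.2 M hM _ (pw_le x 2 M h)

lemma mem_nbr_of (hX : IsOrderIdeal X) {M : Fin r → ℕ} (hM : M ∈ X) {x y : Fin r}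
    (hne : y ≠ x) (hx : 1 ≤ M x) (hy : 1 ≤ M y) : y ∈ nbr X x := by
  simp only [nbr, mem_filter, mem_univ, true_and]
  refine ⟨hne, hX.2 M hM _ (chi_le _ M ?_)⟩
  intro z hz
  rcases mem_insert.1 hz with rfl | hz
  · exact hx
  · rw [mem_singleton.1 hz]; exact hy

lemma nbr_sub (hX : IsOrderIdeal X) (x : Fin r) : nbr X x ⊆ vars X := by
  intro y hy
  simp only [nbr, mem_filter, mem_univ, true_and] at hy
  exact mem_vars_of hX hy.2 (by simp [chi])

lemma loops_sub (hX : IsOrderIdeal X) : loops X ⊆ vars X := by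
  intro y hy
  simp only [loops, mem_filter, mem_univ, true_and] at hy
  exact mem_vars_of hX hy (by simp [pw])

lemma card_deg_zero (hX : IsOrderIdeal X) : #{M ∈ X | monDeg M = 0} = 1 := by
  rw [card_eq_one]
  refine ⟨chi ∅, ?_⟩
  ext M
  simp only [mem_filter, mem_singleton]
  constructor
  · rintro ⟨_, h⟩
    symm
    exact eq_of_le_deg _ _ (chi_le _ _ (by simp)) (by omega)
  · rintro rfl
    obtain ⟨M, hM⟩ := hX.1
    exact ⟨hX.2 M hM _ (chi_le _ _ (by simp)), by rw [monDeg_chi]; rfl⟩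

lemma card_deg_one (hX : IsOrderIdeal X) : #{M ∈ X | monDeg M = 1} = #(vars X) := by
  symm
  rw [← card_image_of_injective _ (pw_inj (r := r) 1 one_ne_zero)]
  congr 1
  ext M
  simp only [mem_filter, mem_image]
  constructor
  · rintro ⟨x, hx, rfl⟩
    simp only [vars, mem_filter, mem_univ, true_and] at hx
    exact ⟨hx, monDeg_pw x 1⟩
  · rintro ⟨hM, hd⟩
    obtain ⟨x, hx⟩ := exists_lt_of_deg (chi ∅) M (by rw [monDeg_chi, hd]; simp)
    have hx1 : 1 ≤ M x := by omega
    refine ⟨x, mem_vars_of hX hM hx1, ?_⟩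
    exact eq_of_le_deg _ _ (pw_le x 1 M hx1) (by rw [monDeg_pw, hd])

lemma mem_cliques_of (hX : IsOrderIdeal X) {e : Finset (Fin r)} (he : chi e ∈ X) :
    e ∈ cls (nbr X) #e (vars X) := by
  rw [mem_cls, mem_powersetCard]
  refine ⟨⟨fun x hx => mem_vars_of hX he (by simp [chi, hx]), rfl⟩, ?_⟩
  intro x hx y hy hxy
  exact mem_nbr_of hX he hxy.symm (by simp [chi, hx]) (by simp [chi, hy])

lemma card_deg_two (hX : IsOrderIdeal X) :
    #{M ∈ X | monDeg M = 2} = #(loops X) + cl (nbr X) 2 (vars X) := by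
  unfold cl
  rw [← card_image_of_injective (loops X) (pw_inj (r := r) 2 two_ne_zero),
    ← card_image_of_injective (cls _ _ _) (chi_inj (r := r)), ← card_union_of_disjoint]
  · congr 1
    ext M
    simp only [mem_filter, mem_union, mem_image, mem_cls]
    constructor
    · rintro ⟨hM, hd⟩
      by_cases h : ∀ x, M x ≤ 1
      · right
        obtain ⟨e, rfl⟩ := eq_chi M h
        have := mem_cliques_of hX hM
        rw [monDeg_chi] at hd
        rw [hd, mem_cls] at this
        exact ⟨e, this, rfl⟩
      · left
        push Not at h
        obtain ⟨x, hx⟩ := h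
        exact ⟨x, mem_loops_of hX hM hx,
          eq_of_le_deg _ _ (pw_le x 2 M hx) (by rw [monDeg_pw, hd])⟩
    · rintro (⟨x, hx, rfl⟩ | ⟨e, ⟨he, he2⟩, rfl⟩)
      · simp only [loops, mem_filter, mem_univ, true_and] at hx
        exact ⟨hx, monDeg_pw x 2⟩
      · have hc := (mem_powersetCard.1 he).2
        refine ⟨?_, by rw [monDeg_chi, hc]⟩
        obtain ⟨x, y, hxy, rfl⟩ := card_eq_two.1 hc
        have := he2 x (by simp) y (by simp) hxy
        simp only [nbr, mem_filter, mem_univ, true_and] at this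
        exact this.2
  · rw [disjoint_left]
    intro M h1 h2
    obtain ⟨x, _, rfl⟩ := mem_image.1 h1
    obtain ⟨e, _, h⟩ := mem_image.1 h2
    have := congrFun h x
    simp only [chi, pw, if_true] at this
    split_ifs at this
    all_goals omega

lemma card_deg_three (hX : IsOrderIdeal X) :
    #{M ∈ X | monDeg M = 3} ≤
      #(loops X) + dsum (nbr X) (vars X) (loops X) + cl (nbr X) 3 (vars X) := by
  set P : Finset (Σ _ : Fin r, Fin r) :=
    (loops X).sigma (fun x => insert x (vars X ∩ nbr X x)) with hP
  have hPc : #P = #(loops X) + dsum (nbr X) (vars X) (loops X) := by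
    rw [hP, card_sigma]
    have h1 : ∀ x ∈ loops X, #(insert x (vars X ∩ nbr X x)) = 1 + #(vars X ∩ nbr X x) := by
      intro x _
      rw [card_insert_of_notMem, add_comm]
      intro h
      exact nbr_irr X x (mem_inter.1 h).2
    rw [sum_congr rfl h1, sum_add_distrib]
    unfold dsum
    rw [← sum_filter, filter_mem_eq_inter, inter_eq_right.2 (loops_sub hX)]
    simp
  have hsub : {M ∈ X | monDeg M = 3} ⊆
      P.image (fun p => fun j => pw p.1 2 j + pw p.2 1 j) ∪
      (cls (nbr X) 3 (vars X)).image chi := by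
    intro M hM
    obtain ⟨hM, hd⟩ := mem_filter.1 hM
    rw [mem_union, mem_image, mem_image]
    by_cases h : ∀ x, M x ≤ 1
    · right
      obtain ⟨e, rfl⟩ := eq_chi M h
      have := mem_cliques_of hX hM
      rw [monDeg_chi] at hd
      rw [hd] at this
      exact ⟨e, this, rfl⟩
    · left
      push Not at h
      obtain ⟨x, hx⟩ := h
      obtain ⟨y, hy⟩ := exists_lt_of_deg (pw x 2) M (by rw [monDeg_pw, hd]; omega)
      refine ⟨⟨x, y⟩, ?_, ?_⟩
      · rw [hP, mem_sigma]
        refine ⟨mem_loops_of hX hM hx, ?_⟩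
        by_cases hyx : y = x
        · simp [hyx]
        · have hx1 : 1 ≤ M x := le_trans one_le_two hx
          have hy1 : 1 ≤ M y := by omega
          exact mem_insert_of_mem (mem_inter.2 ⟨mem_vars_of hX hM hy1,
            mem_nbr_of hX hM hyx hx1 hy1⟩)
      · apply eq_of_le_deg
        · intro j
          show pw x 2 j + pw y 1 j ≤ M j
          by_cases hj : j = y
          · subst hj
            have : pw j 1 j = 1 := by simp [pw]
            omega
          · have h1 : pw y 1 j = 0 := by simp [pw, hj]
            have h2 := pw_le x 2 M hx j
            omega
        · have e1 := monDeg_pw x 2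
          have e2 := monDeg_pw y 1
          unfold monDeg at e1 e2 hd ⊢
          rw [sum_add_distrib]
          dsimp only
          omega
  have h1 := card_le_card hsub
  have h2 := card_union_le (P.image (fun p => fun j => pw p.1 2 j + pw p.2 1 j))
    ((cls (nbr X) 3 (vars X)).image chi)
  have h3 : #(P.image (fun p => fun j => pw p.1 2 j + pw p.2 1 j)) ≤ #P := card_image_le
  have h4 : #((cls (nbr X) 3 (vars X)).image chi)
        ≤ cl (nbr X) 3 (vars X) := card_image_le
  omega

lemma pure_hyp (hX : IsPureWithSocle X 3) (w : Fin r) (hw : w ∈ vars X \ loops X) :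
    (∃ y ∈ nbr X w, y ∈ loops X) ∨ 2 ≤ #(nbr X w) := by
  obtain ⟨hO, _, _, hmax⟩ := hX
  obtain ⟨hwV, hwL⟩ := mem_sdiff.1 hw
  simp only [vars, mem_filter, mem_univ, true_and] at hwV
  obtain ⟨M, hwM, hM⟩ := X.exists_le_maximal hwV
  have hMX : M ∈ X := hM.prop
  have hd : monDeg M = 3 := hmax M ⟨hMX, fun K hK hle => (hM.eq_of_le hK hle).symm⟩
  have hw1 : 1 ≤ M w := by
    have := hwM w
    simpa [pw] using this
  have hw2 : ¬ 2 ≤ M w := fun h => hwL (mem_loops_of hO hMX h)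
  obtain ⟨y, hy⟩ := exists_lt_of_deg (pw w 1) M (by rw [monDeg_pw, hd]; omega)
  have hyw : y ≠ w := by
    rintro rfl
    simp [pw] at hy
    omega
  have hy1 : 1 ≤ M y := by omega
  have hyN := mem_nbr_of hO hMX hyw hw1 hy1
  obtain ⟨z, hz⟩ := exists_lt_of_deg (chi {w, y}) M
    (by rw [monDeg_chi, hd, card_pair hyw.symm]; omega)
  by_cases hzw : z = w
  · subst hzw
    simp [chi] at hz
    omega
  · by_cases hzy : z = y
    · subst hzy
      simp [chi] at hz
      left
      exact ⟨z, hyN, mem_loops_of hO hMX hz⟩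
    · right
      have hz1 : 1 ≤ M z := by omega
      have hzN := mem_nbr_of hO hMX hzw hw1 hz1
      rw [← card_pair hzy]
      apply card_le_card
      intro q hq
      rcases mem_insert.1 hq with rfl | hq
      · exact hzN
      · rw [mem_singleton.1 hq]; exact hyN

lemma deg_two_bound (hX : IsOrderIdeal X) :
    #{M ∈ X | monDeg M = 2} ≤ (#{M ∈ X | monDeg M = 1}) + (#{M ∈ X | monDeg M = 1}).choose 2 := by
  rw [card_deg_one hX, card_deg_two hX]
  exact Nat.add_le_add (card_le_card (loops_sub hX)) (cl_le _ _ _)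

lemma deg_three_bound (hX : IsPureWithSocle X 3) :
    #{M ∈ X | monDeg M = 3} ≤ #{M ∈ X | monDeg M = 2} +
      macaulayBound (#{M ∈ X | monDeg M = 2} - #{M ∈ X | monDeg M = 1}) 2 := by
  have hO := hX.1
  obtain ⟨φ, h1, h2⟩ := exists_partner (nbr X) (nbr_sym X) (nbr_irr X) (vars X) (loops X)
    (nbr_sub hO) (pure_hyp hX)
  obtain ⟨_, h3⟩ := main_graph (nbr X) (nbr_sym X) (nbr_irr X) φ _ (vars X) (loops X) rfl h1 h2
  have h4 := card_deg_three hO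
  have h5 := card_sdiff_add_card_eq_card (loops_sub hO)
  rw [card_deg_one hO, card_deg_two hO]
  have e : #(loops X) + cl (nbr X) 2 (vars X) - #(vars X)
      = cl (nbr X) 2 (vars X) - #(vars X \ loops X) := by omega
  rw [e]
  omega

end Monomials

/-- Every non-decreasing pure O-sequence of socle degree `e ≤ 3`
is differentiable. -/
theorem nondecreasing_pure_socle_le_three_differentiable (h : ℕ → ℕ) (e : ℕ)
    (he : e ≤ 3) (hpure : IsPureOSeq h e)
    (hmono : ∀ i, i + 1 ≤ e → h i ≤ h (i + 1)) :
    IsDifferentiable h e := by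
  obtain ⟨r, X, hX, hH⟩ := hpure
  have hO := hX.1
  have h0 : h 0 = 1 := by rw [hH 0 (by omega), card_deg_zero hO]
  refine ⟨h0, ?_, ?_⟩
  · intro i hi hie
    have := hmono (i - 1) (by omega)
    rwa [Nat.sub_add_cancel hi] at this
  · intro i hi hie
    have hi12 : i = 1 ∨ i = 2 := by omega
    rcases hi12 with rfl | rfl
    · have hb := deg_two_bound hO
      rw [← hH 1 (by omega), ← hH 2 (by omega)] at hb
      have h01 := hmono 0 (by omega)
      simp only [zero_add] at h01
      have e1 : (if (1 : ℕ) + 1 = 0 then 1 else h (1 + 1) - h (1 + 1 - 1)) = h 2 - h 1 := rfl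
      have e2 : (if (1 : ℕ) = 0 then 1 else h 1 - h (1 - 1)) = h 1 - h 0 := rfl
      show (if (1 : ℕ) + 1 = 0 then 1 else h (1 + 1) - h (1 + 1 - 1)) ≤
        macaulayBound (if (1 : ℕ) = 0 then 1 else h 1 - h (1 - 1)) 1
      rw [e1, e2, mb_one, h0, Nat.sub_add_cancel (by omega)]
      omega
    · have he3 : e = 3 := by omega
      subst he3
      have hc := deg_three_bound hX
      rw [← hH 1 (by omega), ← hH 2 (by omega), ← hH 3 (by omega)] at hc
      show h 3 - h 2 ≤ macaulayBound (h 2 - h 1) 2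
      omega
end

section
/- (1, 49, 81, 79, 81) is a pure O-sequence; that is, there exists a pure monomial order ideal (necessarily in 49 variables) whose h-vector is (1, 49, 81, 79, 81). In particular, there exists a non-unimodal pure O-sequence of socle degree 4. -/
namespace PureFortyNine

/-- The first five variables. -/
def S : Finset (Fin 49) := Finset.univ.filter fun j => j.val < 5

/-- The `k`-th block of four variables. -/
def block (k : Fin 11) : Finset (Fin 49) :=
  Finset.univ.filter fun j => 5 ≤ j.val ∧ (j.val - 5) / 4 = k.val

/-- The squarefree monomial with given support. -/
def ind (s : Finset (Fin 49)) : Fin 49 → ℕ := fun j => if j ∈ s then 1 else 0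

/-- The `i`-subsets of the blocks. -/
@[irreducible] def T (i : ℕ) : Finset (Finset (Fin 49)) :=
  Finset.univ.biUnion fun k => Finset.powersetCard i (block k)

/-- The degree `i` part of the order ideal. -/
@[irreducible] def P (i : ℕ) : Finset (Fin 49 → ℕ) := Finset.piAntidiag S i ∪ (T i).image ind

/-- The order ideal. -/
@[irreducible] def X : Finset (Fin 49 → ℕ) := (Finset.range 5).biUnion P

lemma ind_injective : Function.Injective ind := by
  intro s t h
  ext j
  have := congrFun h j
  simp only [ind] at this
  by_cases h1 : j ∈ s <;> by_cases h2 : j ∈ t <;> simp_all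

lemma monDeg_ind (s : Finset (Fin 49)) : monDeg (ind s) = s.card := by
  simp [monDeg, ind]

lemma mem_T {i : ℕ} {s : Finset (Fin 49)} :
    s ∈ T i ↔ ∃ k, s ⊆ block k ∧ s.card = i := by
  simp [T, Finset.mem_powersetCard]

lemma block_card (k : Fin 11) : (block k).card = 4 := by
  revert k; decide +kernel

lemma S_card : S.card = 5 := by decide +kernel

lemma mem_anti {i : ℕ} {M : Fin 49 → ℕ} :
    M ∈ Finset.piAntidiag S i ↔ monDeg M = i ∧ ∀ j, M j ≠ 0 → j ∈ S := by
  rw [Finset.mem_piAntidiag]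
  constructor
  · rintro ⟨h1, h2⟩
    refine ⟨?_, h2⟩
    rw [← h1, monDeg]
    symm
    apply Finset.sum_subset (Finset.subset_univ _)
    intro j _ hj
    by_contra h
    exact hj (h2 j h)
  · rintro ⟨h1, h2⟩
    refine ⟨?_, h2⟩
    rw [← h1, monDeg]
    apply Finset.sum_subset (Finset.subset_univ _)
    intro j _ hj
    by_contra h
    exact hj (h2 j h)

lemma mem_P {i : ℕ} {M : Fin 49 → ℕ} :
    M ∈ P i ↔ (monDeg M = i ∧ ∀ j, M j ≠ 0 → j ∈ S) ∨
      ∃ s k, s ⊆ block k ∧ s.card = i ∧ ind s = M := by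
  rw [P, Finset.mem_union, mem_anti, Finset.mem_image]
  simp only [mem_T]
  constructor
  · rintro (h | ⟨s, ⟨k, h1, h2⟩, h3⟩)
    · exact Or.inl h
    · exact Or.inr ⟨s, k, h1, h2, h3⟩
  · rintro (h | ⟨s, k, h1, h2, h3⟩)
    · exact Or.inl h
    · exact Or.inr ⟨s, ⟨k, h1, h2⟩, h3⟩

lemma deg_P {i : ℕ} {M : Fin 49 → ℕ} (h : M ∈ P i) : monDeg M = i := by
  rcases mem_P.1 h with h | ⟨s, k, _, h2, rfl⟩
  · exact h.1
  · rw [monDeg_ind, h2]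

lemma mem_X {M : Fin 49 → ℕ} : M ∈ X ↔ monDeg M < 5 ∧ M ∈ P (monDeg M) := by
  simp only [X, Finset.mem_biUnion, Finset.mem_range]
  constructor
  · rintro ⟨i, hi, h⟩
    rw [deg_P h]
    exact ⟨hi, h⟩
  · rintro ⟨h1, h2⟩
    exact ⟨_, h1, h2⟩

lemma monDeg_mono {M N : Fin 49 → ℕ} (h : ∀ j, N j ≤ M j) : monDeg N ≤ monDeg M :=
  Finset.sum_le_sum fun j _ => h j

lemma ideal : IsOrderIdeal X := by
  refine ⟨⟨0, ?_⟩, ?_⟩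
  · rw [mem_X, mem_P]
    simp [monDeg]
  · intro M hM N hN
    rw [mem_X] at hM ⊢
    refine ⟨(monDeg_mono hN).trans_lt hM.1, ?_⟩
    rw [mem_P]
    rcases mem_P.1 hM.2 with h | ⟨s, k, h1, h2, rfl⟩
    · left
      refine ⟨rfl, fun j hj => h.2 j ?_⟩
      have := hN j
      omega
    · right
      have e : ind (s.filter fun j => N j ≠ 0) = N := by
        funext j
        have := hN j
        simp only [ind, Finset.mem_filter] at this ⊢
        by_cases hj : j ∈ s <;> simp only [hj, if_true, if_false, true_and, false_and] at this ⊢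
        · split_ifs <;> omega
        · omega
      refine ⟨s.filter fun j => N j ≠ 0, k, (Finset.filter_subset _ _).trans h1, ?_, e⟩
      rw [← monDeg_ind, e]

lemma monDeg_update (M : Fin 49 → ℕ) (a : Fin 49) :
    monDeg (M + Pi.single a 1) = monDeg M + 1 := by
  simp [monDeg, Finset.sum_add_distrib]

lemma pure_X : IsPureWithSocle X 4 := by
  refine ⟨ideal, fun M hM => by have := (mem_X.1 hM).1; omega, ⟨ind (block 0), ?_, ?_⟩, ?_⟩
  · rw [mem_X, monDeg_ind, block_card]
    exact ⟨by norm_num, mem_P.2 (Or.inr ⟨_, 0, subset_rfl, block_card 0, rfl⟩)⟩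
  · rw [monDeg_ind, block_card]
  · rintro M ⟨hM, hmax⟩
    by_contra hne
    have hlt := (mem_X.1 hM).1
    have key : ∀ a, M + Pi.single a 1 ∉ X := by
      intro a ha
      have := hmax _ ha (fun j => by simp)
      have h2 := monDeg_update M a
      rw [this] at h2
      omega
    rcases mem_P.1 (mem_X.1 hM).2 with h | ⟨s, k, h1, h2, rfl⟩
    · apply key 0
      rw [mem_X, monDeg_update]
      refine ⟨by omega, mem_P.2 (Or.inl ⟨monDeg_update _ _, fun j hj => ?_⟩)⟩
      by_cases hj0 : j = 0
      · subst hj0; decide +kernel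
      · apply h.2
        simpa [Pi.single_apply, hj0] using hj
    · rw [monDeg_ind] at hlt hne
      obtain ⟨a, ha, has⟩ : ∃ a ∈ block k, a ∉ s := by
        apply Finset.exists_mem_notMem_of_card_lt_card
        rw [block_card]; omega
      apply key a
      rw [mem_X, monDeg_update, monDeg_ind]
      refine ⟨by omega, mem_P.2 (Or.inr ⟨insert a s, k, ?_, ?_, ?_⟩)⟩
      · exact Finset.insert_subset ha h1
      · exact Finset.card_insert_of_notMem has
      · funext j
        by_cases hj : j = a
        · subst hj; simp [ind, has]
        · simp [ind, hj]

lemma filter_X {i : ℕ} (hi : i ≤ 4) : (X.filter fun M => monDeg M = i) = P i := by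
  ext M
  rw [Finset.mem_filter, mem_X]
  constructor
  · rintro ⟨⟨_, h⟩, e⟩
    rw [e] at h
    exact h
  · intro h
    have e := deg_P h
    rw [e]
    exact ⟨⟨by omega, h⟩, rfl⟩

lemma block_disj {j : Fin 49} {k l : Fin 11} (h1 : j ∈ block k) (h2 : j ∈ block l) : k = l := by
  simp only [block, Finset.mem_filter] at h1 h2
  apply Fin.ext
  omega

lemma card_T {i : ℕ} (hi : 1 ≤ i) : (T i).card = 11 * Nat.choose 4 i := by
  rw [T, Finset.card_biUnion]
  · simp [block_card]
  · intro k _ l _ hkl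
    change Disjoint (Finset.powersetCard i (block k)) (Finset.powersetCard i (block l))
    rw [Finset.disjoint_left]
    intro s hs ht
    rw [Finset.mem_powersetCard] at hs ht
    obtain ⟨j, hj⟩ : s.Nonempty := by
      rw [← Finset.card_pos]; omega
    exact hkl (block_disj (hs.1 hj) (ht.1 hj))

lemma card_P {i : ℕ} (hi : 1 ≤ i) :
    (P i).card = Nat.choose (5 + i - 1) i + 11 * Nat.choose 4 i := by
  rw [P, Finset.card_union_of_disjoint, Finset.card_image_of_injective _ ind_injective, card_T hi]
  · have h := Finset.card_finsuppAntidiag_nat_eq_choose (s := S) i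
    rw [Finset.finsuppAntidiag, Finset.card_map, Finset.card_attach, S_card] at h
    rw [h]
  · rw [Finset.disjoint_left]
    intro M h1 h2
    rw [mem_anti] at h1
    obtain ⟨s, hs, rfl⟩ := Finset.mem_image.1 h2
    obtain ⟨k, hs1, hs2⟩ := mem_T.1 hs
    obtain ⟨j, hj⟩ : s.Nonempty := by
      rw [← Finset.card_pos]; omega
    have a := h1.2 j (by simp [ind, hj])
    have b := hs1 hj
    simp only [S, block, Finset.mem_filter] at a b
    omega

lemma card_P_zero : (P 0).card = 1 := by
  rw [Finset.card_eq_one]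
  refine ⟨0, ?_⟩
  ext M
  rw [Finset.mem_singleton]
  constructor
  · intro h
    have := deg_P h
    rw [monDeg, Finset.sum_eq_zero_iff] at this
    funext j
    exact this j (Finset.mem_univ j)
  · rintro rfl
    exact mem_P.2 (Or.inl ⟨by simp [monDeg], by simp⟩)

lemma hvec : HasHVector X (fun i => [1, 49, 81, 79, 81].getD i 0) 4 := by
  intro i hi
  rw [filter_X hi]
  interval_cases i
  · rw [card_P_zero]; rfl
  all_goals
    rw [card_P (by norm_num)]
    decide +kernel

end PureFortyNine

/-- `(1, 49, 81, 79, 81)` is a pure O-sequence; in particular there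
exists a non-unimodal pure O-sequence of socle degree 4. -/
theorem pure_OSeq_one_49_81_79_81 :
    IsPureOSeq (fun i => [1, 49, 81, 79, 81].getD i 0) 4 ∧
    ∃ h : ℕ → ℕ, IsPureOSeq h 4 ∧
      ¬ ∃ j ≤ 4, (∀ i, i < j → h i ≤ h (i + 1)) ∧
        (∀ i, j ≤ i → i < 4 → h (i + 1) ≤ h i) := by
  have h : IsPureOSeq (fun i => [1, 49, 81, 79, 81].getD i 0) 4 :=
    ⟨49, PureFortyNine.X, PureFortyNine.pure_X, PureFortyNine.hvec⟩
  refine ⟨h, _, h, ?_⟩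
  rintro ⟨j, hj, h1, h2⟩
  by_cases hj2 : j ≤ 2
  · have := h2 3 (by omega) (by norm_num)
    simp at this
  · have := h1 2 (by omega)
    simp at this
end
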